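/- With φ₀(z) := −(1/π)·Li₂(1/z): (i) for every compact subset K of ℂ∖[0,1], Σ_{g∈ℳ} sup_{z∈K} |(L_g φ₀)(z)| < ∞, so Φ := Σ_{g∈ℳ} L_g φ₀ is a well-defined element of 𝒪¹(ℂ̄∖[0,1]); (ii) the limit a₀ := lim_{y→+∞} i·y·Φ(i·y) exists; (iii) the series 𝓑(z) := −iπa₀ + Σ_{n∈ℤ} ( Φ(z − n) − a₀·log((z − n)/(z − n − 1)) ) (principal logarithm) converges absolutely and locally uniformly on ℍ = {Im z > 0}, defining a holomorphic function with 𝓑(z + 1) = 𝓑(z); and (iv) the real part of the complex Brjuno function 𝓑 is bounded on ℍ: sup_{z∈ℍ} |Re 𝓑(z)| < ∞. -/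

import Mathlib

open Complex Filter Set Topology
open scoped ENNReal NNReal

noncomputable section

/-- The complement in `ℂ` of the real segment `[a, b]`. -/
def cutPlane (a b : ℝ) : Set ℂ := (Complex.ofReal '' Set.Icc a b)ᶜ

/-- `𝒪¹(ℂ̄ ∖ [a,b])`: holomorphic on `ℂ ∖ [a,b]`, vanishing at infinity. -/
def O1 (a b : ℝ) : Set (ℂ → ℂ) :=
  {φ | DifferentiableOn ℂ φ (cutPlane a b) ∧
       Tendsto φ (Bornology.cobounded ℂ) (nhds 0)}

/-- `𝒪³(ℂ̄ ∖ [a,b])`: holomorphic on `ℂ ∖ [a,b]`, with `z²ψ(z) → 0` at infinity. -/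
def O3 (a b : ℝ) : Set (ℂ → ℂ) :=
  {ψ | DifferentiableOn ℂ ψ (cutPlane a b) ∧
       Tendsto (fun z => z ^ 2 * ψ z) (Bornology.cobounded ℂ) (nhds 0)}

/-- The `m`-th term (for the integer `m+1 ≥ 1`) of the series defining `T`. -/
def Tterm (φ : ℂ → ℂ) (m : ℕ) (z : ℂ) : ℂ :=
  -z * (φ (z⁻¹ - ((m : ℂ) + 1)) - φ (-((m : ℂ) + 1))) + deriv φ (-((m : ℂ) + 1))

/-- The operator `T`. -/
def Tbrj (φ : ℂ → ℂ) : ℂ → ℂ := fun z => ∑' m : ℕ, Tterm φ m z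

/-- The operator `T⁽³⁾`. -/
def T3brj (ψ : ℂ → ℂ) : ℂ → ℂ := fun z => -∑' m : ℕ, (z⁻¹) ^ 3 * ψ (z⁻¹ - ((m : ℂ) + 1))

/-- `g(m) = (0 1; 1 m)`. -/
def gmat (m : ℤ) : Matrix (Fin 2) (Fin 2) ℤ := !![0, 1; 1, m]

/-- The monoid `ℳ`. -/
def Mmon : Set (Matrix (Fin 2) (Fin 2) ℤ) :=
  {g | g = 1 ∨
    ((g 0 0 * g 1 1 - g 0 1 * g 1 0 = 1 ∨ g 0 0 * g 1 1 - g 0 1 * g 1 0 = -1) ∧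
      g 0 1 ≤ g 1 1 ∧ g 0 0 ≤ g 0 1 ∧ 0 ≤ g 0 0 ∧ g 1 0 ≤ g 1 1 ∧ g 0 0 ≤ g 1 0)}

/-- The operator `L_g` on `𝒪¹(ℂ̄ ∖ [0,1])`, for `g = (a b; c d) ∈ ℳ`. -/
def Lop (g : Matrix (Fin 2) (Fin 2) ℤ) (φ : ℂ → ℂ) : ℂ → ℂ := fun z =>
  if g = 1 then φ z
  else
    ((g 0 0 : ℂ) - (g 1 0 : ℂ) * z) *
        (φ (((g 1 1 : ℂ) * z - (g 0 1 : ℂ)) / ((g 0 0 : ℂ) - (g 1 0 : ℂ) * z)) -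
          φ (-(g 1 1 : ℂ) / (g 1 0 : ℂ))) -
      ((g 0 0 * g 1 1 - g 0 1 * g 1 0 : ℤ) : ℂ) * ((g 1 0 : ℂ))⁻¹ *
        deriv φ (-(g 1 1 : ℂ) / (g 1 0 : ℂ))

/-- `Σ_ℳ φ`, the sum of the family `(L_g φ)_{g ∈ ℳ}`. -/
def sumM (φ : ℂ → ℂ) : ℂ → ℂ := fun z => ∑' g : Mmon, Lop g.1 φ z

/-- The domain `D`. -/
def Dset : Set ℂ :=
  {z | ‖z‖ ≤ 1 ∧ 1 ≤ ‖z - Complex.I‖ ∧ 1 ≤ ‖z + Complex.I‖ ∧ 0 < z.re}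

/-- The domain `D₀`. -/
def D0set : Set ℂ := {z | ‖z + 1‖ ≤ 1 ∧ Real.sqrt 3 / 2 - 1 ≤ z.re}

/-- The domain `D₁`. -/
def D1set : Set ℂ :=
  {z | 1 ≤ ‖z‖ ∧ ‖z - (1 / Real.sqrt 3 : ℝ)‖ ≤ 1 / Real.sqrt 3}

/-- The domain `H₀`. -/
def H0set : Set ℂ := {z | ‖z - Complex.I‖ ≤ 1 ∧ 1 ≤ ‖z + 1‖ ∧ z.im ≤ 1 / 2}

/-- The domain `H₀′`. -/
def H0set' : Set ℂ := {z | (starRingEnd ℂ) z ∈ H0set}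

/-- The domain `Δ`. -/
def Δset : Set ℂ := {z | ‖z‖ ≤ 1 ∧ 1 ≤ ‖z + 1‖ ∧ |z.im| ≤ 1 / 2}

/-- The domain `D∞`. -/
def Dinf : Set ℂ :=
  {z | 1 / 2 < |z.im|} ∪ {z | z.re < Real.sqrt 3 / 2 - 1} ∪
    {z | Real.sqrt 3 / 2 < z.re ∧ 1 / Real.sqrt 3 < ‖z - (1 / Real.sqrt 3 : ℝ)‖}

end

noncomputable section

/-- The principal dilogarithm, `Li₂(z) = −∫₀¹ log(1 − tz)/t dt`. -/
def dilog (z : ℂ) : ℂ := -∫ t in (0 : ℝ)..1, Complex.log (1 - (t : ℂ) * z) / (t : ℂ)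

/-- `φ₀(z) = −(1/π)·Li₂(1/z)`, an element of `𝒪¹(ℂ̄∖[0,1])`. -/
def phi0 (z : ℂ) : ℂ := -(Real.pi : ℂ)⁻¹ * dilog z⁻¹

/-- The complex Brjuno function built from a constant `a₀`:
`𝓑(z) = −iπa₀ + Σ_{n∈ℤ} ( Φ(z−n) − a₀·log((z−n)/(z−n−1)) )` where `Φ = Σ_ℳ φ₀`. -/
def BrjWith (a₀ : ℂ) (z : ℂ) : ℂ :=
  -Complex.I * (Real.pi : ℂ) * a₀ +
    ∑' n : ℤ, (sumM phi0 (z - (n : ℂ)) -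
      a₀ * Complex.log ((z - (n : ℂ)) / (z - (n : ℂ) - 1)))

end

section

open MeasureTheory

/-- The singularity profile of the summand `L_g φ₀` at the rational point `g(0)`. -/
noncomputable def cuspProfile (κ s : ℝ) : ℝ :=
  if 0 < s ∧ s * (1 + κ) < 1 then (1 - κ * s) * (Real.log (1 - κ * s) - Real.log s) else 0

lemma cuspProfile_of_nonpos {κ s : ℝ} (hs : s ≤ 0) : cuspProfile κ s = 0 :=
  if_neg fun h => absurd h.1 hs.not_gt

lemma cuspProfile_of_one_le {κ s : ℝ} (hs : 1 ≤ s * (1 + κ)) : cuspProfile κ s = 0 :=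
  if_neg fun h => absurd h.2 hs.not_gt

lemma cuspProfile_of_one_le' {κ s : ℝ} (hκ : 0 ≤ κ) (hs : 1 ≤ s) : cuspProfile κ s = 0 :=
  cuspProfile_of_one_le (by nlinarith)

lemma cuspProfile_of_le {κ s : ℝ} (hs : 0 < s) (hs' : s * (1 + κ) ≤ 1) :
    cuspProfile κ s = (1 - κ * s) * (Real.log (1 - κ * s) - Real.log s) := by
  rcases hs'.lt_or_eq with h | h
  · exact if_pos ⟨hs, h⟩
  · rw [cuspProfile_of_one_le h.ge]
    have : 1 - κ * s = s := by linarith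
    rw [this]; simp

lemma cuspProfile_nonneg {κ : ℝ} (s : ℝ) : 0 ≤ cuspProfile κ s := by
  unfold cuspProfile
  split_ifs with h
  · have h1 : s ≤ 1 - κ * s := by nlinarith [h.2]
    have := Real.log_le_log h.1 h1
    exact mul_nonneg (by linarith [h.1]) (by linarith)
  · rfl

lemma neg_mul_log_le {x : ℝ} (hx : 0 < x) : -(x * Real.log x) ≤ 1 - x := by
  have h := Real.log_le_sub_one_of_pos (inv_pos.2 hx)
  rw [Real.log_inv] at h
  have := mul_le_mul_of_nonneg_left h hx.le
  rw [mul_sub, mul_inv_cancel₀ hx.ne'] at this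
  linarith

lemma one_sub_div_le_log {x y : ℝ} (hx : 0 < x) (hy : 0 < y) :
    (y - x) / y ≤ Real.log y - Real.log x := by
  have h := Real.log_le_sub_one_of_pos (div_pos hx hy)
  rw [Real.log_div hx.ne' hy.ne'] at h
  have : (y - x) / y = 1 - x / y := by field_simp
  linarith

lemma cuspProfile_sub_le_of_le {κ x y : ℝ} (h0 : 0 ≤ κ) (h1 : κ ≤ 1) (hx : 0 < x) (hxy : x ≤ y)
    (hy : y * (1 + κ) ≤ 1) :
    |cuspProfile κ x - cuspProfile κ y| ≤ 3 * (Real.log y - Real.log x) := by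
  have hy0 : 0 < y := hx.trans_le hxy
  have hκxy : κ * x ≤ κ * y := mul_le_mul_of_nonneg_left hxy h0
  have hx' : x * (1 + κ) ≤ 1 := by nlinarith
  have hPy : y ≤ 1 - κ * y := by nlinarith
  have hPy0 : 0 < 1 - κ * y := hy0.trans_le hPy
  have hPx0 : 0 < 1 - κ * x := by linarith
  rw [cuspProfile_of_le hx hx', cuspProfile_of_le hy0 hy]
  have hl := one_sub_div_le_log hx hy0
  have hl0 : 0 ≤ (y - x) / y := div_nonneg (by linarith) hy0.le
  have hAy0 : 0 ≤ Real.log (1 - κ * y) - Real.log y := by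
    linarith [Real.log_le_log hy0 hPy]
  have hmono : Real.log (1 - κ * y) ≤ Real.log (1 - κ * x) :=
    Real.log_le_log hPy0 (by linarith)
  have hAy : κ * (y - x) * (Real.log (1 - κ * y) - Real.log y) ≤ (y - x) / y := by
    have h2 : Real.log (1 - κ * y) - Real.log y ≤ 1 / y := by
      have := Real.log_le_sub_one_of_pos (div_pos hPy0 hy0)
      rw [Real.log_div hPy0.ne' hy0.ne'] at this
      have h3 : (1 - κ * y) / y ≤ 1 / y := by gcongr; nlinarith
      linarith
    calc κ * (y - x) * (Real.log (1 - κ * y) - Real.log y) ≤ 1 * (y - x) * (1 / y) := by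
          gcongr
      _ = (y - x) / y := by ring
  have hq : Real.log (1 - κ * x) - Real.log (1 - κ * y) ≤ (y - x) / y := by
    have := Real.log_le_sub_one_of_pos (div_pos hPx0 hPy0)
    rw [Real.log_div hPx0.ne' hPy0.ne'] at this
    have h3 : (1 - κ * x) / (1 - κ * y) - 1 = κ * (y - x) / (1 - κ * y) := by
      field_simp; ring
    have h4 : κ * (y - x) / (1 - κ * y) ≤ 1 * (y - x) / y := by gcongr
    rw [one_mul] at h4
    linarith
  set A := Real.log (1 - κ * x)
  set B := Real.log (1 - κ * y)
  set lx := Real.log x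
  set ly := Real.log y
  have e : (1 - κ * x) * (A - lx) - (1 - κ * y) * (B - ly)
      = (1 - κ * x) * ((A - lx) - (B - ly)) + κ * (y - x) * (B - ly) := by ring
  have hd0 : 0 ≤ (A - lx) - (B - ly) := by linarith
  have hd1 : (1 - κ * x) * ((A - lx) - (B - ly)) ≤ 1 * ((A - lx) - (B - ly)) := by
    gcongr; nlinarith
  have hn : 0 ≤ κ * (y - x) * (B - ly) := by
    apply mul_nonneg (mul_nonneg h0 (by linarith)) hAy0
  rw [e, abs_of_nonneg (by positivity)]
  linarith

lemma cuspProfile_sub_le {κ x y : ℝ} (h0 : 0 ≤ κ) (h1 : κ ≤ 1) (hx : 0 < x) (hy : 0 < y) :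
    |cuspProfile κ x - cuspProfile κ y| ≤ 3 * |Real.log x - Real.log y| := by
  wlog hxy : x ≤ y generalizing x y
  · rw [abs_sub_comm, abs_sub_comm (Real.log x)]
    exact this hy hx (le_of_not_ge hxy)
  have hlog := Real.log_le_log hx hxy
  rw [abs_sub_comm (Real.log x), abs_of_nonneg (by linarith : 0 ≤ Real.log y - Real.log x)]
  by_cases hys : y * (1 + κ) ≤ 1
  · exact cuspProfile_sub_le_of_le h0 h1 hx hxy hys
  push Not at hys
  rw [cuspProfile_of_one_le hys.le]
  by_cases hxs : x * (1 + κ) ≤ 1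
  · have hk : 0 < 1 + κ := by linarith
    have e : (1 + κ)⁻¹ * (1 + κ) = 1 := inv_mul_cancel₀ hk.ne'
    have hxt : x ≤ (1 + κ)⁻¹ := by rw [← one_div, le_div_iff₀ hk]; exact hxs
    have := cuspProfile_sub_le_of_le h0 h1 hx hxt e.le
    rw [cuspProfile_of_one_le e.ge] at this
    have h3 : (1 + κ)⁻¹ ≤ y := by rw [← one_div, div_le_iff₀ hk]; exact hys.le
    have := Real.log_le_log (by positivity) h3
    linarith
  · rw [cuspProfile_of_one_le (not_le.1 hxs).le]
    simp; linarith

lemma cuspProfile_bounds {κ s : ℝ} (h0 : 0 ≤ κ) (h1 : κ ≤ 1) (hs : 0 < s) (hs1 : s ≤ 1) :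
    -Real.log s - 3 * √s ≤ cuspProfile κ s ∧ cuspProfile κ s ≤ -Real.log s := by
  have hr0 : 0 < √s := Real.sqrt_pos.2 hs
  have hrr : √s * √s = s := Real.mul_self_sqrt hs.le
  have hr1 : √s ≤ 1 := Real.sqrt_le_one.2 hs1
  have hlog : Real.log s ≤ 0 := Real.log_nonpos hs.le hs1
  by_cases h : s * (1 + κ) ≤ 1
  · rw [cuspProfile_of_le hs h]
    have hP : s ≤ 1 - κ * s := by nlinarith
    have hP0 : 0 < 1 - κ * s := by linarith
    have hP1 : 1 - κ * s ≤ 1 := by nlinarith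
    have e1 := neg_mul_log_le hP0
    have e2 : -(s * Real.log s) ≤ 2 * √s := by
      have e3 := neg_mul_log_le hr0
      have e4 : Real.log s = 2 * Real.log (√s) := by
        conv_lhs => rw [← hrr]
        rw [Real.log_mul hr0.ne' hr0.ne']; ring
      have e5 : -(s * Real.log s) = 2 * √s * -(√s * Real.log √s) := by
        rw [e4]; linear_combination (2 * Real.log √s) * hrr
      rw [e5]
      nlinarith
    have e5 : κ * -(s * Real.log s) ≤ 1 * -(s * Real.log s) := by
      gcongr; nlinarith
    have e6 : κ * s ≤ √s := by nlinarith
    have e7 : (1 - κ * s) * Real.log (1 - κ * s) ≤ 0 :=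
      mul_nonpos_of_nonneg_of_nonpos hP0.le (Real.log_nonpos hP0.le hP1)
    constructor <;> nlinarith
  · push Not at h
    rw [cuspProfile_of_one_le h.le]
    have : 1 / 2 ≤ s := by nlinarith
    have h2 := neg_mul_log_le hs
    constructor <;> nlinarith

lemma abs_cuspProfile_sub_cuspProfile_le {κ κ' s : ℝ} (h0 : 0 ≤ κ) (h1 : κ ≤ 1) (h0' : 0 ≤ κ')
    (h1' : κ' ≤ 1) (hs : 0 < s) : |cuspProfile κ s - cuspProfile κ' s| ≤ 3 * √s := by
  by_cases hs1 : s ≤ 1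
  · have := cuspProfile_bounds h0 h1 hs hs1
    have := cuspProfile_bounds h0' h1' hs hs1
    rw [abs_le]; constructor <;> linarith
  · push Not at hs1
    rw [cuspProfile_of_one_le' h0 hs1.le, cuspProfile_of_one_le' h0' hs1.le]
    simp

/-- The two-sided profile obtained by gluing the profiles of a pair of summands. -/
noncomputable def twoSidedProfile (κ κ' s : ℝ) : ℝ := cuspProfile κ s + cuspProfile κ' (-s)

lemma twoSidedProfile_of_pos {κ κ' s : ℝ} (hs : 0 < s) :
    twoSidedProfile κ κ' s = cuspProfile κ s := by
  simp [twoSidedProfile, cuspProfile_of_nonpos (neg_neg_of_pos hs).le]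

lemma twoSidedProfile_neg (κ κ' s : ℝ) : twoSidedProfile κ κ' (-s) = twoSidedProfile κ' κ s := by
  simp [twoSidedProfile, add_comm]

lemma twoSidedProfile_of_one_le {κ κ' s : ℝ} (h0 : 0 ≤ κ) (h0' : 0 ≤ κ') (hs : 1 ≤ |s|) :
    twoSidedProfile κ κ' s = 0 := by
  rcases le_abs.1 hs with h | h
  · simp [twoSidedProfile, cuspProfile_of_one_le' h0 h,
      cuspProfile_of_nonpos (by linarith : -s ≤ 0)]
  · simp [twoSidedProfile, cuspProfile_of_one_le' h0' h,
      cuspProfile_of_nonpos (by linarith : s ≤ 0)]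

lemma twoSidedProfile_sub_le {κ κ' x y : ℝ} (h0 : 0 ≤ κ) (h1 : κ ≤ 1) (h0' : 0 ≤ κ')
    (h1' : κ' ≤ 1) (hx : x ≠ 0) (hy : y ≠ 0) :
    |twoSidedProfile κ κ' x - twoSidedProfile κ κ' y|
      ≤ 3 * |Real.log x - Real.log y| + 3 * √|x - y| := by
  wlog hx0 : 0 < x generalizing x y κ κ'
  · have := this h0' h1' h0 h1 (neg_ne_zero.2 hx) (neg_ne_zero.2 hy)
      (by rw [neg_pos]; exact lt_of_le_of_ne (not_lt.1 hx0) hx)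
    rw [twoSidedProfile_neg, twoSidedProfile_neg, Real.log_neg_eq_log, Real.log_neg_eq_log] at this
    rwa [show -x - -y = -(x - y) by ring, abs_neg] at this
  rw [twoSidedProfile_of_pos hx0]
  rcases lt_or_gt_of_ne hy with hy0 | hy0
  · obtain ⟨t, rfl⟩ : ∃ t, y = -t := ⟨-y, by ring⟩
    have ht : 0 < t := by linarith
    rw [twoSidedProfile_neg, twoSidedProfile_of_pos ht, Real.log_neg_eq_log]
    have e1 := cuspProfile_sub_le h0 h1 hx0 ht
    have e2 := abs_cuspProfile_sub_cuspProfile_le h0 h1 h0' h1' ht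
    have e3 : √t ≤ √|x - -t| := Real.sqrt_le_sqrt (by rw [abs_of_pos] <;> linarith)
    have := abs_sub_le (cuspProfile κ x) (cuspProfile κ t) (cuspProfile κ' t)
    linarith
  · rw [twoSidedProfile_of_pos hy0]
    have := cuspProfile_sub_le h0 h1 hx0 hy0
    have := Real.sqrt_nonneg |x - y|
    linarith

lemma measurable_cuspProfile (κ : ℝ) : Measurable (cuspProfile κ) := by
  unfold cuspProfile
  refine Measurable.ite (p := fun s => 0 < s ∧ s * (1 + κ) < 1) ?_ ?_ measurable_const
  · exact measurableSet_Ioi.inter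
      (measurableSet_lt (measurable_id.mul_const (1 + κ)) measurable_const)
  · have := Real.measurable_log
    fun_prop

lemma integrableOn_neg_log : IntegrableOn (fun y => -Real.log y) (Ioc 0 1) := by
  have h : IntervalIntegrable Real.log volume 0 1 := intervalIntegral.intervalIntegrable_log'
  exact ((intervalIntegrable_iff_integrableOn_Ioc_of_le zero_le_one).1 h).neg

lemma integral_neg_log : ∫ y in Ioc (0 : ℝ) 1, -Real.log y = 1 := by
  rw [← intervalIntegral.integral_of_le zero_le_one, intervalIntegral.integral_neg, integral_log]
  simp

lemma cuspProfile_le_indicator {κ : ℝ} (h0 : 0 ≤ κ) (h1 : κ ≤ 1) (s : ℝ) :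
    cuspProfile κ s ≤ (Ioc (0 : ℝ) 1).indicator (fun y => -Real.log y) s := by
  by_cases hs : s ∈ Ioc (0 : ℝ) 1
  · rw [indicator_of_mem hs]
    exact (cuspProfile_bounds h0 h1 hs.1 hs.2).2
  · rw [indicator_of_notMem hs]
    rw [mem_Ioc, not_and_or, not_lt, not_le] at hs
    rcases hs with h | h
    · rw [cuspProfile_of_nonpos h]
    · rw [cuspProfile_of_one_le' h0 h.le]

lemma integrable_cuspProfile {κ : ℝ} (h0 : 0 ≤ κ) (h1 : κ ≤ 1) : Integrable (cuspProfile κ) := by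
  refine Integrable.mono' (integrableOn_neg_log.integrable_indicator measurableSet_Ioc)
    (measurable_cuspProfile κ).aestronglyMeasurable (ae_of_all _ fun s => ?_)
  rw [Real.norm_of_nonneg (cuspProfile_nonneg s)]
  exact cuspProfile_le_indicator h0 h1 s

lemma integral_cuspProfile_le {κ : ℝ} (h0 : 0 ≤ κ) (h1 : κ ≤ 1) : ∫ s, cuspProfile κ s ≤ 1 := by
  rw [← integral_neg_log, ← integral_indicator measurableSet_Ioc]
  exact integral_mono (integrable_cuspProfile h0 h1)
    (integrableOn_neg_log.integrable_indicator measurableSet_Ioc)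
    (cuspProfile_le_indicator h0 h1)

lemma twoSidedProfile_nonneg (κ κ' s : ℝ) : 0 ≤ twoSidedProfile κ κ' s :=
  add_nonneg (cuspProfile_nonneg s) (cuspProfile_nonneg (-s))

lemma integrable_twoSidedProfile {κ κ' : ℝ} (h0 : 0 ≤ κ) (h1 : κ ≤ 1) (h0' : 0 ≤ κ')
    (h1' : κ' ≤ 1) : Integrable (twoSidedProfile κ κ') :=
  (integrable_cuspProfile h0 h1).add (integrable_cuspProfile h0' h1').comp_neg

lemma integral_twoSidedProfile_le {κ κ' : ℝ} (h0 : 0 ≤ κ) (h1 : κ ≤ 1) (h0' : 0 ≤ κ')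
    (h1' : κ' ≤ 1) : ∫ s, twoSidedProfile κ κ' s ≤ 2 := by
  unfold twoSidedProfile
  rw [integral_add (integrable_cuspProfile h0 h1) (integrable_cuspProfile h0' h1').comp_neg,
    integral_neg_eq_self (fun s => cuspProfile κ' s)]
  linarith [integral_cuspProfile_le h0 h1, integral_cuspProfile_le h0' h1']

/-- The real part of the Cauchy kernel `1 / (s - ξ - iη)`. -/
noncomputable def conjKernel (η s : ℝ) : ℝ := s / (s ^ 2 + η ^ 2)

lemma conjKernel_neg (η s : ℝ) : conjKernel η (-s) = -conjKernel η s := by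
  simp [conjKernel, neg_div]

lemma abs_conjKernel_le (η s : ℝ) : |conjKernel η s| ≤ 1 / |s| := by
  unfold conjKernel
  rcases eq_or_ne s 0 with rfl | hs
  · simp
  rw [abs_div, div_le_div_iff₀ (by positivity) (by positivity), abs_of_pos (a := s ^ 2 + η ^ 2)
    (by positivity), ← abs_mul, ← sq, abs_of_nonneg (sq_nonneg s)]
  nlinarith [sq_nonneg η]

lemma continuous_conjKernel {η : ℝ} (hη : η ≠ 0) : Continuous (conjKernel η) := by
  unfold conjKernel
  refine continuous_id.div (by fun_prop) fun s => ?_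
  positivity

lemma abs_conjKernel_le' {η : ℝ} (hη : η ≠ 0) (s : ℝ) : |conjKernel η s| ≤ 1 / |η| := by
  unfold conjKernel
  rw [abs_div, div_le_div_iff₀ (by positivity) (by positivity), abs_of_pos (a := s ^ 2 + η ^ 2)
    (by positivity), one_mul]
  have := sq_abs s
  have := sq_abs η
  nlinarith [abs_nonneg s, abs_nonneg η]

lemma integrable_mul_conjKernel {f : ℝ → ℝ} (hf : Integrable f) {η : ℝ} (hη : η ≠ 0) (ξ : ℝ) :
    Integrable (fun s => f s * conjKernel η (s - ξ)) :=
  hf.mul_bdd (c := 1 / |η|)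
    ((continuous_conjKernel hη).comp (continuous_id.sub continuous_const)).aestronglyMeasurable
    (ae_of_all _ fun _ => abs_conjKernel_le' hη _)

lemma integral_mul_conjKernel {f : ℝ → ℝ} (hf : Integrable f) {η : ℝ} (hη : η ≠ 0) (ξ : ℝ) :
    ∫ s, f s * conjKernel η (s - ξ)
      = ∫ t in Ioi (0 : ℝ), (f (ξ + t) - f (ξ - t)) * conjKernel η t := by
  have hi := (integrable_mul_conjKernel hf hη ξ).comp_add_left ξ
  have e1 : ∫ s, f s * conjKernel η (s - ξ) = ∫ t, f (ξ + t) * conjKernel η t := by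
    rw [← integral_add_left_eq_self _ ξ]
    simp
  simp only [add_sub_cancel_left] at hi
  rw [e1, ← integral_add_compl (measurableSet_Ioi (a := (0 : ℝ))) hi, compl_Ioi]
  have e2 : ∫ t in Iic (0 : ℝ), f (ξ + t) * conjKernel η t
      = ∫ t in Ioi (0 : ℝ), -(f (ξ - t) * conjKernel η t) := by
    have := integral_comp_neg_Ioi (0 : ℝ) (fun t => f (ξ + t) * conjKernel η t)
    rw [neg_zero] at this
    rw [← this]
    simp [conjKernel_neg, ← sub_eq_add_neg]
  have hi' : Integrable (fun t => f (ξ - t) * conjKernel η t) := by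
    have := hi.comp_neg
    simpa [conjKernel_neg, ← sub_eq_add_neg] using this.neg
  have hi'' : Integrable (fun t => -(f (ξ - t) * conjKernel η t)) := hi'.neg
  rw [e2, ← integral_add hi.integrableOn hi''.integrableOn]
  congr 1 with t
  ring

/-- The modulus of symmetric variation of `log |s|`. -/
noncomputable def logVariation (u : ℝ) : ℝ := |Real.log (1 + u) - Real.log (1 - u)| / u

lemma measurable_logVariation : Measurable logVariation := by
  unfold logVariation; fun_prop

lemma integrableOn_logVariation : IntegrableOn logVariation (Ioi 0) := by
  have hu : Ioi (0 : ℝ) = Ioc 0 (1 / 2) ∪ Ioc (1 / 2) 2 ∪ Ioi 2 := by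
    rw [Ioc_union_Ioc_eq_Ioc, Ioc_union_Ioi_eq_Ioi] <;> norm_num
  rw [hu]
  have hm {s : Set ℝ} : AEStronglyMeasurable logVariation (volume.restrict s) :=
    measurable_logVariation.aestronglyMeasurable
  refine (IntegrableOn.union ?_ ?_).union ?_
  · refine Integrable.mono' (g := fun _ => 4) (integrableOn_const (by simp)) hm ?_
    refine (ae_restrict_iff' measurableSet_Ioc).2 (ae_of_all _ fun u hu => ?_)
    obtain ⟨h0, h1⟩ := hu
    have e := Real.log_le_sub_one_of_pos (x := (1 + u) / (1 - u))
      (div_pos (by linarith) (by linarith))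
    rw [Real.log_div (by linarith) (by linarith)] at e
    have e2 : (1 + u) / (1 - u) - 1 ≤ 4 * u := by
      rw [sub_le_iff_le_add, div_le_iff₀ (by linarith)]; nlinarith
    have e3 : Real.log (1 - u) ≤ Real.log (1 + u) := Real.log_le_log (by linarith) (by linarith)
    rw [Real.norm_eq_abs, logVariation, abs_div, abs_abs, abs_of_pos h0, div_le_iff₀ h0,
      abs_of_nonneg (by linarith)]
    linarith
  · have i1 : IntegrableOn (fun u => Real.log (1 + u)) (Ioc (1 / 2) 2) := by
      refine (intervalIntegrable_iff_integrableOn_Ioc_of_le (by norm_num)).1 ?_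
      have := (intervalIntegral.intervalIntegrable_log' (a := 3 / 2) (b := 3)).comp_add_left 1
      convert this using 1 <;> norm_num
    have i2 : IntegrableOn (fun u => Real.log (1 - u)) (Ioc (1 / 2) 2) := by
      refine (intervalIntegrable_iff_integrableOn_Ioc_of_le (by norm_num)).1 ?_
      have := (intervalIntegral.intervalIntegrable_log' (a := 1 / 2) (b := -1)).comp_sub_left 1
      convert this using 1 <;> norm_num
    refine Integrable.mono' ((i1.abs.add i2.abs).mul_const 2) hm ?_
    refine (ae_restrict_iff' measurableSet_Ioc).2 (ae_of_all _ fun u hu => ?_)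
    obtain ⟨h0, h1⟩ := hu
    have hu0 : 0 < u := by linarith
    rw [Real.norm_eq_abs, logVariation, abs_div, abs_abs, abs_of_pos hu0, div_le_iff₀ hu0]
    have := abs_sub (Real.log (1 + u)) (Real.log (1 - u))
    have hn : 0 ≤ |Real.log (1 + u)| + |Real.log (1 - u)| := by positivity
    simp only [Pi.add_apply]
    nlinarith
  · refine Integrable.mono' (g := fun u => 4 * u ^ (-2 : ℝ))
      ((integrableOn_Ioi_rpow_of_lt (by norm_num) (by norm_num)).const_mul 4) hm ?_
    refine (ae_restrict_iff' measurableSet_Ioi).2 (ae_of_all _ fun u hu => ?_)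
    have h0 : 2 < u := hu
    have e := Real.log_le_sub_one_of_pos (x := (1 + u) / (u - 1))
      (div_pos (by linarith) (by linarith))
    rw [Real.log_div (by linarith) (by linarith)] at e
    have e2 : (1 + u) / (u - 1) - 1 ≤ 4 / u := by
      rw [sub_le_iff_le_add, div_le_iff₀ (by linarith)]
      have : 4 / u * u = 4 := div_mul_cancel₀ _ (by linarith)
      have : 4 / u ≤ 2 := by rw [div_le_iff₀] <;> linarith
      nlinarith
    have e3 : Real.log (u - 1) ≤ Real.log (1 + u) := Real.log_le_log (by linarith) (by linarith)
    rw [Real.norm_eq_abs, logVariation, abs_div, abs_abs, abs_of_pos (by linarith : 0 < u),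
      show (1 : ℝ) - u = -(u - 1) by ring, Real.log_neg_eq_log,
      div_le_iff₀ (by linarith), abs_of_nonneg (by linarith), Real.rpow_neg (by linarith),
      Real.rpow_two]
    refine (e.trans e2).trans_eq ?_
    field_simp

lemma logVariation_nonneg {u : ℝ} (hu : 0 ≤ u) : 0 ≤ logVariation u :=
  div_nonneg (abs_nonneg _) hu

lemma abs_log_sub_div_eq (ξ : ℝ) {t : ℝ} (ht : 0 < t) (hne : t ≠ |ξ|) :
    |Real.log (ξ + t) - Real.log (ξ - t)| / t = |ξ|⁻¹ * logVariation (|ξ|⁻¹ * t) := by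
  rcases eq_or_ne ξ 0 with rfl | hξ
  · simp
  have ha : 0 < |ξ| := abs_pos.2 hξ
  have e1 : |Real.log (ξ + t) - Real.log (ξ - t)|
      = |Real.log (|ξ| + t) - Real.log (|ξ| - t)| := by
    rcases abs_cases ξ with ⟨h, -⟩ | ⟨h, -⟩
    · rw [h]
    · rw [h, abs_sub_comm, ← Real.log_neg_eq_log (ξ - t), ← Real.log_neg_eq_log (ξ + t)]
      congr 3 <;> ring
  have e2 : |ξ| + t = |ξ| * (1 + |ξ|⁻¹ * t) := by field_simp
  have e3 : |ξ| - t = |ξ| * (1 - |ξ|⁻¹ * t) := by field_simp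
  have n2 : 1 + |ξ|⁻¹ * t ≠ 0 := by positivity
  have n3 : 1 - |ξ|⁻¹ * t ≠ 0 := by
    intro h
    rw [h, mul_zero] at e3
    exact hne (by linarith)
  rw [e1, e2, e3, Real.log_mul ha.ne' n2, Real.log_mul ha.ne' n3, logVariation]
  field_simp
  congr 1
  ring

lemma integrableOn_scaled_logVariation (ξ : ℝ) :
    IntegrableOn (fun t => |ξ|⁻¹ * logVariation (|ξ|⁻¹ * t)) (Ioi 0) := by
  rcases eq_or_ne ξ 0 with rfl | hξ
  · simp
  have ha : 0 < |ξ|⁻¹ := inv_pos.2 (abs_pos.2 hξ)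
  refine Integrable.const_mul ?_ _
  have := (integrableOn_Ioi_comp_mul_left_iff logVariation 0 ha).2
  rw [mul_zero] at this
  exact this integrableOn_logVariation

lemma integral_scaled_logVariation_le (ξ : ℝ) :
    ∫ t in Ioi (0 : ℝ), |ξ|⁻¹ * logVariation (|ξ|⁻¹ * t) ≤ ∫ u in Ioi (0 : ℝ), logVariation u := by
  rcases eq_or_ne ξ 0 with rfl | hξ
  · simpa using setIntegral_nonneg measurableSet_Ioi fun u hu => logVariation_nonneg (le_of_lt hu)
  have ha : 0 < |ξ|⁻¹ := inv_pos.2 (abs_pos.2 hξ)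
  rw [integral_const_mul, integral_comp_mul_left_Ioi logVariation 0 ha, mul_zero, smul_eq_mul,
    mul_inv_cancel_left₀ ha.ne']

lemma integrable_indicator_rpow :
    Integrable ((Ioc (0 : ℝ) 3).indicator fun t => 2 * t ^ (-(1 / 2) : ℝ)) := by
  refine IntegrableOn.integrable_indicator ?_ measurableSet_Ioc
  refine Integrable.const_mul ?_ _
  exact (intervalIntegrable_iff_integrableOn_Ioc_of_le (by norm_num)).1
    (intervalIntegral.intervalIntegrable_rpow' (by norm_num))

lemma abs_twoSidedProfile_sub_mul_le {κ κ' : ℝ} (h0 : 0 ≤ κ) (h1 : κ ≤ 1) (h0' : 0 ≤ κ')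
    (h1' : κ' ≤ 1) {ξ : ℝ} (hξ : |ξ| ≤ 2) (η : ℝ) {t : ℝ} (ht : 0 < t) (hne : t ≠ |ξ|) :
    |(twoSidedProfile κ κ' (ξ + t) - twoSidedProfile κ κ' (ξ - t)) * conjKernel η t|
      ≤ 3 * (|ξ|⁻¹ * logVariation (|ξ|⁻¹ * t))
        + 3 * (Ioc (0 : ℝ) 3).indicator (fun t => 2 * t ^ (-(1 / 2) : ℝ)) t := by
  have hξ' := abs_le.1 hξ
  have hlv : 0 ≤ |ξ|⁻¹ * logVariation (|ξ|⁻¹ * t) :=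
    mul_nonneg (by positivity) (logVariation_nonneg (by positivity))
  by_cases ht3 : t ≤ 3
  · rw [indicator_of_mem (mem_Ioc.2 ⟨ht, ht3⟩), ← abs_log_sub_div_eq ξ ht hne, abs_mul]
    have hK := abs_conjKernel_le η t
    rw [abs_of_pos ht] at hK
    have n1 : ξ + t ≠ 0 := by
      intro h; apply hne; rw [show ξ = -t by linarith, abs_neg, abs_of_pos ht]
    have n2 : ξ - t ≠ 0 := by
      intro h; apply hne; rw [show ξ = t by linarith, abs_of_pos ht]
    have hD := twoSidedProfile_sub_le h0 h1 h0' h1' n1 n2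
    have hs : √|ξ + t - (ξ - t)| ≤ 2 * √t := by
      rw [show ξ + t - (ξ - t) = 2 * t by ring, abs_of_pos (by linarith)]
      refine Real.sqrt_le_iff.2 ⟨by positivity, ?_⟩
      rw [mul_pow, Real.sq_sqrt ht.le]; linarith
    have e : t ^ (-(1 / 2) : ℝ) = √t / t := by
      rw [Real.rpow_neg ht.le, ← Real.sqrt_eq_rpow, inv_eq_one_div,
        div_eq_div_iff (Real.sqrt_pos.2 ht).ne' ht.ne', one_mul, Real.mul_self_sqrt ht.le]
    rw [e]
    calc _ ≤ (3 * |Real.log (ξ + t) - Real.log (ξ - t)| + 3 * (2 * √t)) * (1 / t) := by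
          gcongr; linarith
      _ = _ := by ring
  · push Not at ht3
    rw [twoSidedProfile_of_one_le h0 h0', twoSidedProfile_of_one_le h0 h0',
      indicator_of_notMem fun h => absurd h.2 ht3.not_ge]
    · simpa using hlv
    · rw [le_abs]; right; linarith
    · rw [le_abs]; left; linarith

/-- The conjugate Poisson integral of a glued profile is bounded and decays at infinity. -/
lemma exists_conjKernel_twoSidedProfile_le :
    ∃ C : ℝ, 0 ≤ C ∧ ∀ κ κ' ξ η : ℝ, 0 ≤ κ → κ ≤ 1 → 0 ≤ κ' → κ' ≤ 1 → η ≠ 0 →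
      |∫ s, twoSidedProfile κ κ' s * conjKernel η (s - ξ)| ≤ C / (1 + |ξ|) := by
  set J := ∫ u in Ioi (0 : ℝ), logVariation u with hJ
  set J' := ∫ t in Ioi (0 : ℝ), (Ioc (0 : ℝ) 3).indicator (fun t => 2 * t ^ (-(1 / 2) : ℝ)) t
    with hJ'
  have hJ0 : 0 ≤ J := setIntegral_nonneg measurableSet_Ioi
    fun u hu => logVariation_nonneg (le_of_lt hu)
  have hJ0' : 0 ≤ J' := setIntegral_nonneg measurableSet_Ioi fun t ht =>
    indicator_nonneg (fun u hu => mul_nonneg zero_le_two (Real.rpow_nonneg hu.1.le _)) t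
  refine ⟨3 * (3 * J + 3 * J') + 6, by positivity, fun κ κ' ξ η h0 h1 h0' h1' hη => ?_⟩
  have hH := integrable_twoSidedProfile h0 h1 h0' h1'
  rw [le_div_iff₀ (by positivity)]
  by_cases hξ : |ξ| ≤ 2
  · have key : |∫ s, twoSidedProfile κ κ' s * conjKernel η (s - ξ)| ≤ 3 * J + 3 * J' := by
      rw [integral_mul_conjKernel hH hη]
      have i1 := (integrableOn_scaled_logVariation ξ).const_mul 3
      have i2 := (integrable_indicator_rpow.integrableOn (s := Ioi 0)).const_mul 3
      have := norm_integral_le_of_norm_le (i1.add i2) (f := fun t =>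
        (twoSidedProfile κ κ' (ξ + t) - twoSidedProfile κ κ' (ξ - t)) * conjKernel η t) ?_
      · refine this.trans ?_
        simp only [Pi.add_apply]
        rw [integral_add i1 i2, integral_const_mul, integral_const_mul 3]
        gcongr
        exact integral_scaled_logVariation_le ξ
      · have hne : ∀ᵐ t ∂volume.restrict (Ioi (0 : ℝ)), t ≠ |ξ| :=
          ae_restrict_of_ae (Measure.ae_ne volume _)
        filter_upwards [hne, ae_restrict_mem measurableSet_Ioi] with t ht ht0
        exact abs_twoSidedProfile_sub_mul_le h0 h1 h0' h1' hξ η ht0 ht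
    nlinarith [abs_nonneg ξ, abs_nonneg (∫ s, twoSidedProfile κ κ' s * conjKernel η (s - ξ))]
  · push Not at hξ
    have key : |∫ s, twoSidedProfile κ κ' s * conjKernel η (s - ξ)| ≤ 2 * (3 / (1 + |ξ|)) := by
      have := norm_integral_le_of_norm_le (hH.mul_const (3 / (1 + |ξ|))) (f := fun s =>
        twoSidedProfile κ κ' s * conjKernel η (s - ξ)) (ae_of_all _ fun s => ?_)
      · refine this.trans ?_
        rw [integral_mul_const]
        gcongr
        exact integral_twoSidedProfile_le h0 h1 h0' h1'
      · rw [norm_mul, Real.norm_of_nonneg (twoSidedProfile_nonneg _ _ _), Real.norm_eq_abs]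
        by_cases hs : 1 ≤ |s|
        · rw [twoSidedProfile_of_one_le h0 h0' hs]; simp
        · push Not at hs
          refine mul_le_mul_of_nonneg_left ?_ (twoSidedProfile_nonneg _ _ _)
          refine (abs_conjKernel_le η _).trans ?_
          have : |ξ| - |s| ≤ |s - ξ| := by rw [abs_sub_comm]; exact abs_sub_abs_le_abs_sub _ _
          rw [div_le_div_iff₀] <;> linarith
    have e : 2 * (3 / (1 + |ξ|)) * (1 + |ξ|) = 6 := by field_simp; norm_num
    have := mul_le_mul_of_nonneg_right key (by positivity : 0 ≤ 1 + |ξ|)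
    rw [e] at this
    linarith

/-- The distance to the segment `[0, 1]`. -/
noncomputable def segDist (z : ℂ) : ℝ := Metric.infDist z (Complex.ofReal '' Icc (0 : ℝ) 1)

lemma isCompact_ofReal_Icc : IsCompact (Complex.ofReal '' Icc (0 : ℝ) 1) :=
  isCompact_Icc.image Complex.continuous_ofReal

lemma segDist_le {z : ℂ} {x : ℝ} (hx : x ∈ Icc (0 : ℝ) 1) : segDist z ≤ ‖(x : ℂ) - z‖ := by
  rw [← dist_eq_norm, dist_comm]
  exact Metric.infDist_le_dist_of_mem (mem_image_of_mem _ hx)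

lemma segDist_pos {z : ℂ} (hz : z ∈ cutPlane 0 1) : 0 < segDist z :=
  (isCompact_ofReal_Icc.isClosed.notMem_iff_infDist_pos (by simp)).1 hz

lemma isOpen_cutPlane : IsOpen (cutPlane 0 1) := isCompact_ofReal_Icc.isClosed.isOpen_compl

lemma continuous_segDist : Continuous segDist := Metric.continuous_infDist_pt _

lemma le_segDist {z : ℂ} {r : ℝ} (h : ∀ x ∈ Icc (0 : ℝ) 1, r ≤ ‖(x : ℂ) - z‖) : r ≤ segDist z := by
  refine (Metric.le_infDist (by simp)).2 ?_
  rintro _ ⟨x, hx, rfl⟩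
  rw [dist_comm, dist_eq_norm]
  exact h x hx

lemma sub_ne_zero_of_mem_cutPlane {z : ℂ} (hz : z ∈ cutPlane 0 1) {x : ℝ}
    (hx : x ∈ Icc (0 : ℝ) 1) : (x : ℂ) - z ≠ 0 :=
  norm_pos_iff.1 ((segDist_pos hz).trans_le (segDist_le hx))

lemma hasDerivAt_integral_div_sub {w γ : ℝ → ℝ} (hw : IntegrableOn w (Ioc 0 1))
    (hγm : Measurable γ) (hγ : ∀ y ∈ Ioc (0 : ℝ) 1, γ y ∈ Icc (0 : ℝ) 1) {z : ℂ}
    (hz : z ∈ cutPlane 0 1) :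
    IntegrableOn (fun y => (w y : ℂ) / (γ y - z)) (Ioc 0 1) ∧
    IntegrableOn (fun y => (w y : ℂ) / (γ y - z) ^ 2) (Ioc 0 1) ∧
    HasDerivAt (fun z => ∫ y in Ioc (0 : ℝ) 1, (w y : ℂ) / (γ y - z))
      (∫ y in Ioc (0 : ℝ) 1, (w y : ℂ) / (γ y - z) ^ 2) z := by
  have hδ := segDist_pos hz
  have hwm : AEStronglyMeasurable (fun y => (w y : ℂ)) (volume.restrict (Ioc 0 1)) :=
    Complex.continuous_ofReal.comp_aestronglyMeasurable hw.aestronglyMeasurable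
  have hmeas (x : ℂ) : AEStronglyMeasurable (fun y => (w y : ℂ) / (γ y - x))
      (volume.restrict (Ioc 0 1)) :=
    hwm.div₀ ((Complex.measurable_ofReal.comp hγm).sub_const x).aestronglyMeasurable
  have hmeas2 : AEStronglyMeasurable (fun y => (w y : ℂ) / (γ y - z) ^ 2)
      (volume.restrict (Ioc 0 1)) :=
    hwm.div₀ (((Complex.measurable_ofReal.comp hγm).sub_const z).pow_const 2).aestronglyMeasurable
  have hi : IntegrableOn (fun y => (w y : ℂ) / (γ y - z)) (Ioc 0 1) := by
    refine Integrable.mono' (hw.norm.div_const (segDist z)) (hmeas z) ?_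
    refine (ae_restrict_iff' measurableSet_Ioc).2 (ae_of_all _ fun y hy => ?_)
    rw [norm_div, Complex.norm_real]
    gcongr
    exact segDist_le (hγ y hy)
  have hball : ∀ x ∈ Metric.ball z (segDist z / 2), ∀ y ∈ Ioc (0 : ℝ) 1,
      segDist z / 2 ≤ ‖(γ y : ℂ) - x‖ := by
    intro x hx y hy
    have h1 := segDist_le (z := z) (hγ y hy)
    rw [Metric.mem_ball, dist_eq_norm] at hx
    have : ‖(γ y : ℂ) - z‖ ≤ ‖(γ y : ℂ) - x‖ + ‖x - z‖ := by
      refine le_trans (le_of_eq ?_) (norm_add_le _ _); congr 1; ring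
    linarith
  refine ⟨hi, hasDerivAt_integral_of_dominated_loc_of_deriv_le
    (F' := fun x y => (w y : ℂ) / (γ y - x) ^ 2)
    (bound := fun y => ‖w y‖ / (segDist z / 2) ^ 2)
    (Metric.ball_mem_nhds z (half_pos hδ)) (Eventually.of_forall hmeas) hi hmeas2 ?_
    (hw.norm.div_const _) ?_⟩
  · refine (ae_restrict_iff' measurableSet_Ioc).2 (ae_of_all _ fun y hy x hx => ?_)
    rw [norm_div, Complex.norm_real, norm_pow]
    gcongr
    exact hball x hx y hy
  · refine (ae_restrict_iff' measurableSet_Ioc).2 (ae_of_all _ fun y hy x hx => ?_)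
    have hne : (γ y : ℂ) - x ≠ 0 :=
      norm_pos_iff.1 ((half_pos hδ).trans_le (hball x hx y hy))
    have := ((hasDerivAt_const x (w y : ℂ)).div ((hasDerivAt_id x).const_sub (γ y : ℂ)) hne)
    simp only [id_eq, zero_mul, mul_neg, mul_one, zero_sub, neg_neg] at this
    exact this

lemma one_sub_mul_inv_mem_slitPlane {z : ℂ} (hz : z ∈ cutPlane 0 1) {t : ℝ}
    (ht : t ∈ Icc (0 : ℝ) 1) : 1 - (t : ℂ) * z⁻¹ ∈ slitPlane := by
  have hz0 : z ≠ 0 := by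
    rintro rfl; exact hz ⟨0, by simp, by simp⟩
  rw [mem_slitPlane_iff_not_le_zero]
  intro h
  rw [Complex.le_def] at h
  obtain ⟨hre, him⟩ := h
  set u := 1 - (t : ℂ) * z⁻¹ with hu
  have e : u = (u.re : ℂ) := Complex.ext (by simp) (by simpa using him)
  have h1 : (t : ℂ) = (1 - (u.re : ℂ)) * z := by
    rw [← e, hu]; field_simp; ring
  simp only [zero_re] at hre
  have hpos : 0 < 1 - u.re := by linarith
  refine hz ⟨t / (1 - u.re), ⟨div_nonneg ht.1 hpos.le, ?_⟩, ?_⟩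
  · rw [div_le_one hpos]; linarith [ht.2]
  · push_cast
    rw [h1, mul_div_cancel_left₀]
    exact_mod_cast hpos.ne'

lemma phi0_eq {z : ℂ} (hz : z ∈ cutPlane 0 1) :
    phi0 z = (Real.pi : ℂ)⁻¹ * ∫ y in Ioc (0 : ℝ) 1, ((-Real.log y : ℝ) : ℂ) / ((y : ℝ) - z) := by
  have hz0 : z ≠ 0 := by
    rintro rfl; exact hz ⟨0, by simp, by simp⟩
  set w := z⁻¹ with hw
  set f : ℝ → ℂ := fun t => Complex.log (1 - (t : ℂ) * w) with hf
  have hfd : ∀ t ∈ Icc (0 : ℝ) 1, HasDerivAt f (-w / (1 - (t : ℂ) * w)) t := by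
    intro t ht
    have h1 : HasDerivAt (fun t : ℝ => 1 - (t : ℂ) * w) (-w) t := by
      simpa using ((Complex.ofRealCLM.hasDerivAt (x := t)).mul_const w).const_sub 1
    exact h1.clog_real (one_sub_mul_inv_mem_slitPlane hz ht)
  have hf0 : f 0 = 0 := by simp [hf]
  have hfc : ContinuousOn f (Icc 0 1) := fun t ht => (hfd t ht).continuousAt.continuousWithinAt
  set q : ℝ → ℂ := dslope f 0 with hq
  have hqf : ∀ t : ℝ, (t : ℂ) * q t = f t := by
    intro t
    have := sub_smul_dslope f 0 t
    rw [sub_zero, hf0, sub_zero] at this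
    simpa using this
  have hqc : ContinuousOn q (Icc 0 1) := by
    intro t ht
    refine ContinuousAt.continuousWithinAt ?_
    rcases eq_or_ne t 0 with rfl | h0
    · exact continuousAt_dslope_same.2 (hfd 0 ht).differentiableAt
    · exact (continuousAt_dslope_of_ne h0).2 (hfd t ht).continuousAt
  have hu : uIcc (0 : ℝ) 1 = Icc 0 1 := uIcc_of_le zero_le_one
  have hqi : IntervalIntegrable (fun t : ℝ => f t / (t : ℂ)) volume 0 1 := by
    have : IntervalIntegrable q volume 0 1 := (hu ▸ hqc).intervalIntegrable
    refine this.congr ?_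
    intro t ht
    rw [uIoc_of_le zero_le_one] at ht
    have : (t : ℂ) ≠ 0 := by exact_mod_cast ht.1.ne'
    simp only
    rw [← hqf t, mul_div_cancel_left₀ _ this]
  have hkc : ContinuousOn (fun t : ℝ => -w / (1 - (t : ℂ) * w)) (Icc 0 1) := by
    refine ContinuousOn.div continuousOn_const (by fun_prop) fun t ht => ?_
    exact slitPlane_ne_zero (one_sub_mul_inv_mem_slitPlane hz ht)
  have hli : IntervalIntegrable (fun t : ℝ => (Real.log t : ℂ) * (-w / (1 - (t : ℂ) * w)))
      volume 0 1 := by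
    have h1 : IntervalIntegrable Real.log volume 0 1 := intervalIntegral.intervalIntegrable_log'
    have h2 : IntervalIntegrable (fun t => (Real.log t : ℂ)) volume 0 1 :=
      ⟨h1.1.ofReal, h1.2.ofReal⟩
    exact h2.mul_continuousOn (hu ▸ hkc)
  have hG := intervalIntegral.integral_eq_sub_of_hasDerivAt_of_le (a := 0) (b := 1)
    (f := fun t : ℝ => ((t * Real.log t : ℝ) : ℂ) * q t)
    (f' := fun t : ℝ => f t / (t : ℂ) + (Real.log t : ℂ) * (-w / (1 - (t : ℂ) * w)))
    zero_le_one
    ((Complex.continuous_ofReal.comp Real.continuous_mul_log).continuousOn.mul hqc) ?_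
    (hqi.add hli)
  · rw [intervalIntegral.integral_add hqi hli] at hG
    simp only [Real.log_one, mul_zero, ofReal_zero, zero_mul, sub_self] at hG
    have hd : dilog w = ∫ t in (0 : ℝ)..1, (Real.log t : ℂ) * (-w / (1 - (t : ℂ) * w)) := by
      rw [dilog]
      linear_combination -hG
    rw [phi0, ← hw, hd, intervalIntegral.integral_of_le zero_le_one, neg_mul, ← mul_neg,
      ← integral_neg]
    congr 1
    refine setIntegral_congr_fun measurableSet_Ioc fun t ht => ?_
    have h1 := slitPlane_ne_zero (one_sub_mul_inv_mem_slitPlane hz ⟨ht.1.le, ht.2⟩)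
    have h2 := sub_ne_zero_of_mem_cutPlane hz (x := t) ⟨ht.1.le, ht.2⟩
    rw [hw]
    push_cast
    have h3 : 1 - (t : ℂ) * z⁻¹ = -(((t : ℂ) - z) / z) := by field_simp; ring
    rw [h3]
    field_simp
  · intro t ht
    have hlog : HasDerivAt (fun t : ℝ => (Real.log t : ℂ)) (((t⁻¹ : ℝ)) : ℂ) t :=
      (Real.hasDerivAt_log ht.1.ne').ofReal_comp
    have hm := hlog.mul (hfd t ⟨ht.1.le, ht.2.le⟩)
    have he : (fun t : ℝ => ((t * Real.log t : ℝ) : ℂ) * q t)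
        = (fun t : ℝ => (Real.log t : ℂ)) * f := by
      ext t
      simp only [Pi.mul_apply]
      rw [← hqf t]; push_cast; ring
    have hv : f t / (t : ℂ) + (Real.log t : ℂ) * (-w / (1 - (t : ℂ) * w))
        = ((t⁻¹ : ℝ) : ℂ) * f t + (Real.log t : ℂ) * (-w / (1 - (t : ℂ) * w)) := by
      push_cast; ring
    rw [he, hv]
    exact hm

lemma hasDerivAt_phi0 {z : ℂ} (hz : z ∈ cutPlane 0 1) :
    HasDerivAt phi0 ((Real.pi : ℂ)⁻¹ *
      ∫ y in Ioc (0 : ℝ) 1, ((-Real.log y : ℝ) : ℂ) / ((y : ℝ) - z) ^ 2) z := by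
  have h := (hasDerivAt_integral_div_sub integrableOn_neg_log measurable_id
    (fun y hy => ⟨hy.1.le, hy.2⟩) hz).2.2.const_mul (Real.pi : ℂ)⁻¹
  refine h.congr_of_eventuallyEq ?_
  filter_upwards [isOpen_cutPlane.mem_nhds hz] with x hx
  exact phi0_eq hx

lemma Mmon_bounds {g : Matrix (Fin 2) (Fin 2) ℤ} (hg : g ∈ Mmon) :
    0 ≤ g 0 0 ∧ 0 ≤ g 0 1 ∧ g 0 1 ≤ g 1 1 ∧ 0 ≤ g 1 0 ∧ g 1 0 ≤ g 1 1 ∧ 1 ≤ g 1 1 ∧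
      g 0 0 + g 0 1 ≤ g 1 0 + g 1 1 ∧
      (g 0 0 * g 1 1 - g 0 1 * g 1 0 = 1 ∨ g 0 0 * g 1 1 - g 0 1 * g 1 0 = -1) := by
  rcases hg with rfl | ⟨hdet, h1, h2, h3, h4, h5⟩
  · simp
  · refine ⟨h3, by omega, h1, by omega, h4, ?_, by omega, hdet⟩
    by_contra h
    have hd : g 1 1 = 0 := by omega
    have hb : g 0 1 = 0 := by omega
    rw [hd, hb] at hdet
    omega

lemma Mmon_one_le {g : Matrix (Fin 2) (Fin 2) ℤ} (hg : g ∈ Mmon) (h1 : g ≠ 1) :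
    1 ≤ g 1 0 ∧ g 0 0 ≤ g 1 0 := by
  rcases hg with rfl | ⟨hdet, h1, h2, h3, h4, h5⟩
  · exact absurd rfl h1
  · refine ⟨?_, h5⟩
    by_contra h
    have hc : g 1 0 = 0 := by omega
    have ha : g 0 0 = 0 := by omega
    rw [hc, ha] at hdet
    omega

/-- The Möbius action of `g` on the real line. -/
noncomputable def mobius (g : Matrix (Fin 2) (Fin 2) ℤ) (y : ℝ) : ℝ :=
  (g 0 0 * y + g 0 1) / (g 1 0 * y + g 1 1)

/-- The density of the summand `L_g φ₀` in the coordinate `y = g⁻¹ x`. -/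
noncomputable def logWeight (g : Matrix (Fin 2) (Fin 2) ℤ) (y : ℝ) : ℝ :=
  -Real.log y / (g 1 0 * y + g 1 1) ^ 3

lemma le_denom {g : Matrix (Fin 2) (Fin 2) ℤ} (hg : g ∈ Mmon) {y : ℝ} (hy : 0 ≤ y) :
    (g 1 1 : ℝ) ≤ g 1 0 * y + g 1 1 ∧ (1 : ℝ) ≤ g 1 1 := by
  obtain ⟨-, -, -, hc, -, hd, -⟩ := Mmon_bounds hg
  have : (0 : ℝ) ≤ g 1 0 := by exact_mod_cast hc
  exact ⟨by nlinarith, by exact_mod_cast hd⟩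

lemma mobius_mem {g : Matrix (Fin 2) (Fin 2) ℤ} (hg : g ∈ Mmon) {y : ℝ} (hy : y ∈ Icc (0 : ℝ) 1) :
    mobius g y ∈ Icc (0 : ℝ) 1 := by
  obtain ⟨ha, hb, hbd, hc, hcd, hd, hs, -⟩ := Mmon_bounds hg
  obtain ⟨e1, e2⟩ := le_denom hg hy.1
  have ha' : (0 : ℝ) ≤ g 0 0 := by exact_mod_cast ha
  have hb' : (0 : ℝ) ≤ g 0 1 := by exact_mod_cast hb
  have hbd' : (g 0 1 : ℝ) ≤ g 1 1 := by exact_mod_cast hbd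
  have hs' : (g 0 0 : ℝ) + g 0 1 ≤ g 1 0 + g 1 1 := by exact_mod_cast hs
  have hp : 0 < (g 1 0 : ℝ) * y + g 1 1 := by linarith
  refine ⟨div_nonneg (add_nonneg (mul_nonneg ha' hy.1) hb') hp.le, ?_⟩
  unfold mobius
  rw [div_le_one hp]
  nlinarith [hy.1, hy.2]

lemma measurable_mobius (g : Matrix (Fin 2) (Fin 2) ℤ) : Measurable (mobius g) := by
  unfold mobius; fun_prop

lemma logWeight_bounds {g : Matrix (Fin 2) (Fin 2) ℤ} (hg : g ∈ Mmon) {y : ℝ}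
    (hy : y ∈ Ioc (0 : ℝ) 1) :
    0 ≤ logWeight g y ∧ logWeight g y ≤ -Real.log y / (g 1 1 : ℝ) ^ 3 := by
  obtain ⟨e1, e2⟩ := le_denom hg hy.1.le
  have hl : 0 ≤ -Real.log y := by linarith [Real.log_nonpos hy.1.le hy.2]
  have hd : (0 : ℝ) < g 1 1 := by linarith
  refine ⟨div_nonneg hl (pow_nonneg (by linarith) 3), ?_⟩
  unfold logWeight
  gcongr

lemma integrableOn_logWeight {g : Matrix (Fin 2) (Fin 2) ℤ} (hg : g ∈ Mmon) :
    IntegrableOn (logWeight g) (Ioc 0 1) := by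
  refine Integrable.mono' (integrableOn_neg_log.div_const ((g 1 1 : ℝ) ^ 3)) ?_ ?_
  · have := Real.measurable_log
    refine Measurable.aestronglyMeasurable ?_
    unfold logWeight
    fun_prop
  · refine (ae_restrict_iff' measurableSet_Ioc).2 (ae_of_all _ fun y hy => ?_)
    have := logWeight_bounds hg hy
    rw [Real.norm_of_nonneg this.1]
    exact this.2

/-- Total mass of the density of `L_g φ₀`. -/
noncomputable def summandMass (g : Matrix (Fin 2) (Fin 2) ℤ) : ℝ :=
  Real.pi⁻¹ * ∫ y in Ioc (0 : ℝ) 1, logWeight g y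

lemma summandMass_nonneg {g : Matrix (Fin 2) (Fin 2) ℤ} (hg : g ∈ Mmon) : 0 ≤ summandMass g :=
  mul_nonneg (inv_nonneg.2 Real.pi_pos.le)
    (setIntegral_nonneg measurableSet_Ioc fun _ hy => (logWeight_bounds hg hy).1)

lemma summandMass_le {g : Matrix (Fin 2) (Fin 2) ℤ} (hg : g ∈ Mmon) :
    summandMass g ≤ 1 / (g 1 1 : ℝ) ^ 3 := by
  have h1 : ∫ y in Ioc (0 : ℝ) 1, logWeight g y ≤ 1 / (g 1 1 : ℝ) ^ 3 := by
    have := setIntegral_mono_on (integrableOn_logWeight hg)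
      (integrableOn_neg_log.div_const ((g 1 1 : ℝ) ^ 3))
      measurableSet_Ioc fun y hy => (logWeight_bounds hg hy).2
    rwa [integral_div, integral_neg_log] at this
  have h0 : 0 ≤ ∫ y in Ioc (0 : ℝ) 1, logWeight g y :=
    setIntegral_nonneg measurableSet_Ioc fun _ hy => (logWeight_bounds hg hy).1
  have hpi : Real.pi⁻¹ ≤ 1 := inv_le_one_of_one_le₀ (by linarith [Real.pi_gt_three])
  unfold summandMass
  nlinarith

lemma Lop_phi0_eq {g : Matrix (Fin 2) (Fin 2) ℤ} (hg : g ∈ Mmon) {z : ℂ} (hz : z ∈ cutPlane 0 1) :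
    Lop g phi0 z
      = (Real.pi : ℂ)⁻¹ * ∫ y in Ioc (0 : ℝ) 1, (logWeight g y : ℂ) / (mobius g y - z) := by
  by_cases h1 : g = 1
  · subst h1
    rw [Lop, if_pos rfl, phi0_eq hz]
    simp [logWeight, mobius]
  obtain ⟨hc, hac⟩ := Mmon_one_le hg h1
  obtain ⟨ha, hb, hbd, -, hcd, hd, hs, hdet⟩ := Mmon_bounds hg
  have hcR : (1 : ℝ) ≤ g 1 0 := by exact_mod_cast hc
  have hdR : (1 : ℝ) ≤ g 1 1 := by exact_mod_cast hd
  have hc0 : (g 1 0 : ℂ) ≠ 0 := by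
    have : g 1 0 ≠ 0 := by omega
    exact_mod_cast this
  have hacz : (g 0 0 : ℂ) - g 1 0 * z ≠ 0 := by
    have := sub_ne_zero_of_mem_cutPlane hz (x := (g 0 0 : ℝ) / g 1 0)
      ⟨div_nonneg (by exact_mod_cast ha) (by linarith),
        (div_le_one (by linarith)).2 (by exact_mod_cast hac)⟩
    intro h
    apply this
    push_cast
    rw [sub_eq_zero, div_eq_iff hc0]
    linear_combination h
  have hε : (((g 0 0 * g 1 1 - g 0 1 * g 1 0 : ℤ) : ℂ)) ^ 2 = 1 := by
    rcases hdet with h | h <;> rw [h] <;> norm_num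
  have hden : ∀ y ∈ Icc (0 : ℝ) 1, (g 1 0 : ℂ) * y + g 1 1 ≠ 0 := by
    intro y hy
    have := le_denom hg hy.1
    have : (g 1 0 : ℝ) * y + g 1 1 ≠ 0 := by linarith
    exact_mod_cast this
  have hnum : ∀ y ∈ Icc (0 : ℝ) 1,
      (g 0 0 : ℂ) * y + g 0 1 - z * (g 1 0 * y + g 1 1) ≠ 0 := by
    intro y hy h
    apply sub_ne_zero_of_mem_cutPlane hz (mobius_mem hg hy)
    have := hden y hy
    unfold mobius
    push_cast
    rw [sub_eq_zero, div_eq_iff this]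
    linear_combination h
  have hM : (((g 1 1 : ℂ) * z - g 0 1) / ((g 0 0 : ℂ) - g 1 0 * z)) ∈ cutPlane 0 1 := by
    rintro ⟨y, hy, he⟩
    rw [eq_div_iff hacz] at he
    exact hnum y hy (by linear_combination he)
  have hdc : (-(g 1 1 : ℂ) / (g 1 0 : ℂ)) ∈ cutPlane 0 1 := by
    rintro ⟨y, hy, he⟩
    rw [eq_div_iff hc0] at he
    exact hden y hy (by linear_combination he)
  have hid : ∀ y ∈ Ioc (0 : ℝ) 1, id y ∈ Icc (0 : ℝ) 1 := fun y hy => ⟨hy.1.le, hy.2⟩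
  have iM := (hasDerivAt_integral_div_sub integrableOn_neg_log measurable_id hid hM).1
  obtain ⟨idc, idc2, -⟩ :=
    hasDerivAt_integral_div_sub integrableOn_neg_log measurable_id hid hdc
  simp only [id_eq] at iM idc idc2
  rw [Lop, if_neg h1, phi0_eq hM, phi0_eq hdc, (hasDerivAt_phi0 hdc).deriv]
  have hcomb : ((g 0 0 : ℂ) - g 1 0 * z) *
      ((∫ y in Ioc (0 : ℝ) 1, ((-Real.log y : ℝ) : ℂ) /
          ((y : ℂ) - ((g 1 1 : ℂ) * z - g 0 1) / ((g 0 0 : ℂ) - g 1 0 * z)))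
        - ∫ y in Ioc (0 : ℝ) 1, ((-Real.log y : ℝ) : ℂ) / ((y : ℂ) - -(g 1 1 : ℂ) / (g 1 0 : ℂ)))
      - ((g 0 0 * g 1 1 - g 0 1 * g 1 0 : ℤ) : ℂ) * ((g 1 0 : ℂ))⁻¹ *
        (∫ y in Ioc (0 : ℝ) 1, ((-Real.log y : ℝ) : ℂ) /
          ((y : ℂ) - -(g 1 1 : ℂ) / (g 1 0 : ℂ)) ^ 2)
      = ∫ y in Ioc (0 : ℝ) 1, (logWeight g y : ℂ) / (mobius g y - z) := by
    have iMd := iM.sub idc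
    rw [← integral_sub iM idc, ← integral_const_mul, ← integral_const_mul]
    refine (integral_sub (iMd.const_mul _) (idc2.const_mul _)).symm.trans ?_
    refine setIntegral_congr_fun measurableSet_Ioc fun y hy => ?_
    have hy' : y ∈ Icc (0 : ℝ) 1 := ⟨hy.1.le, hy.2⟩
    have n1 := hden y hy'
    have n2 := hnum y hy'
    have e1 : (y : ℂ) - ((g 1 1 : ℂ) * z - g 0 1) / ((g 0 0 : ℂ) - g 1 0 * z)
        = ((g 0 0 : ℂ) * y + g 0 1 - z * (g 1 0 * y + g 1 1)) / ((g 0 0 : ℂ) - g 1 0 * z) := by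
      rw [eq_div_iff hacz, sub_mul, div_mul_cancel₀ _ hacz]; ring
    have e2 : (y : ℂ) - -(g 1 1 : ℂ) / (g 1 0 : ℂ) = (g 1 0 * y + g 1 1) / (g 1 0 : ℂ) := by
      rw [eq_div_iff hc0, sub_mul, div_mul_cancel₀ _ hc0]; ring
    have e3 : (mobius g y : ℂ) - z
        = ((g 0 0 : ℂ) * y + g 0 1 - z * (g 1 0 * y + g 1 1)) / (g 1 0 * y + g 1 1) := by
      unfold mobius
      push_cast
      rw [eq_div_iff n1, sub_mul, div_mul_cancel₀ _ n1]
    have e4 : (logWeight g y : ℂ) = ((-Real.log y : ℝ) : ℂ) / (g 1 0 * y + g 1 1) ^ 3 := by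
      unfold logWeight
      push_cast
      rfl
    rw [Pi.sub_apply, e1, e2, e3, e4]
    push_cast at hε ⊢
    generalize (-(Real.log y : ℂ)) = l
    generalize (y : ℂ) = t at *
    generalize (g 0 0 : ℂ) = a at *
    generalize (g 0 1 : ℂ) = b at *
    generalize (g 1 0 : ℂ) = c at *
    generalize (g 1 1 : ℂ) = d at *
    obtain ⟨D, hD⟩ : ∃ D, D = c * t + d := ⟨_, rfl⟩
    obtain ⟨N, hN⟩ : ∃ N, N = a * t + b - z * D := ⟨_, rfl⟩
    rw [← hD] at n1 n2 ⊢
    rw [← hN] at n2 ⊢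
    simp only [div_div_eq_mul_div, div_pow]
    field_simp
    have h : (a - c * z) * D - c * N = a * d - b * c := by rw [hN, hD]; ring
    linear_combination (l * ((a - c * z) * D) + l * (a * d - b * c)) * h + l * hε
  rw [← hcomb]
  ring

lemma integral_cuspProfile_mul {κ : ℝ} (hκ : 0 ≤ κ) (F : ℝ → ℝ) :
    ∫ s, cuspProfile κ s * F s
      = ∫ y in Ioc (0 : ℝ) 1, -Real.log y / (κ * y + 1) ^ 3 * F (y / (κ * y + 1)) := by
  have hp : ∀ y ∈ Ioo (0 : ℝ) 1, 0 < κ * y + 1 := fun y hy => by nlinarith [hy.1]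
  have himg : (fun y => y / (κ * y + 1)) '' Ioo (0 : ℝ) 1 = {s | 0 < s ∧ s * (1 + κ) < 1} := by
    ext s
    constructor
    · rintro ⟨y, hy, rfl⟩
      have := hp y hy
      refine ⟨div_pos hy.1 this, ?_⟩
      rw [div_mul_eq_mul_div, div_lt_one this]
      nlinarith [hy.1, hy.2]
    · rintro ⟨h0, h1⟩
      have h2 : 0 < 1 - κ * s := by nlinarith
      refine ⟨s / (1 - κ * s), ⟨div_pos h0 h2, (div_lt_one h2).2 (by linarith)⟩, ?_⟩
      have : κ * (s / (1 - κ * s)) + 1 = 1 / (1 - κ * s) := by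
        field_simp; ring
      dsimp only
      rw [this, div_div_div_cancel_right₀ h2.ne', div_one]
  have hder : ∀ y ∈ Ioo (0 : ℝ) 1, HasDerivWithinAt (fun y => y / (κ * y + 1))
      (1 / (κ * y + 1) ^ 2) (Ioo 0 1) y := by
    intro y hy
    have h := (hasDerivAt_id y).div (((hasDerivAt_id y).const_mul κ).add_const 1) (hp y hy).ne'
    refine (h.congr_deriv ?_).hasDerivWithinAt
    simp only [id]
    congr 1
    ring
  have hinj : InjOn (fun y => y / (κ * y + 1)) (Ioo (0 : ℝ) 1) := by
    intro x hx y hy hxy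
    dsimp only at hxy
    rw [div_eq_div_iff (hp x hx).ne' (hp y hy).ne'] at hxy
    linarith
  have hcv := integral_image_eq_integral_abs_deriv_smul measurableSet_Ioo hder hinj
    (fun s => cuspProfile κ s * F s)
  rw [himg] at hcv
  rw [← setIntegral_eq_integral_of_forall_compl_eq_zero (s := {s | 0 < s ∧ s * (1 + κ) < 1}),
    hcv, integral_Ioc_eq_integral_Ioo]
  · refine setIntegral_congr_fun measurableSet_Ioo fun y hy => ?_
    have h := hp y hy
    have hs : 0 < y / (κ * y + 1) := div_pos hy.1 h
    have h1 : 1 - κ * (y / (κ * y + 1)) = 1 / (κ * y + 1) := by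
      field_simp; ring
    have h2 : y / (κ * y + 1) * (1 + κ) ≤ 1 := by
      rw [div_mul_eq_mul_div, div_le_one h]
      nlinarith [hy.1, hy.2]
    rw [cuspProfile_of_le hs h2, h1, Real.log_div one_ne_zero h.ne', Real.log_div hy.1.ne' h.ne',
      Real.log_one, smul_eq_mul, abs_of_pos (by positivity)]
    field_simp
    ring
  · intro s hs
    rw [mem_ofPred_eq] at hs
    rw [cuspProfile, if_neg hs, zero_mul]

/-- The determinant of an element of `ℳ`, a sign. -/
noncomputable def monSign (g : Matrix (Fin 2) (Fin 2) ℤ) : ℝ :=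
  ((g 0 0 * g 1 1 - g 0 1 * g 1 0 : ℤ) : ℝ)

lemma monSign_eq {g : Matrix (Fin 2) (Fin 2) ℤ} (hg : g ∈ Mmon) :
    monSign g = 1 ∨ monSign g = -1 := by
  obtain ⟨-, -, -, -, -, -, -, h | h⟩ := Mmon_bounds hg <;> simp [monSign, h]

lemma re_ofReal_div_sub (w γ : ℝ) (z : ℂ) :
    ((w : ℂ) / (γ - z)).re = w * conjKernel z.im (γ - z.re) := by
  rw [Complex.div_re, conjKernel, Complex.normSq_apply]
  simp only [ofReal_re, sub_re, ofReal_im, zero_mul, zero_div, add_zero, sub_im, zero_sub]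
  rw [mul_div_assoc]
  congr 2
  ring

lemma mem_cutPlane_of_im_ne_zero {z : ℂ} (hz : z.im ≠ 0) : z ∈ cutPlane 0 1 := by
  rintro ⟨x, -, rfl⟩
  exact hz (ofReal_im x)

lemma re_Lop_phi0 {g : Matrix (Fin 2) (Fin 2) ℤ} (hg : g ∈ Mmon) {z : ℂ} (hz : z.im ≠ 0) :
    (Lop g phi0 z).re = monSign g / (Real.pi * g 1 1) *
      ∫ s, cuspProfile (g 1 0 / g 1 1) s * conjKernel ((g 1 1 : ℝ) ^ 2 * z.im)
        (s - monSign g * ((g 1 1 : ℝ) ^ 2 * (z.re - g 0 1 / g 1 1))) := by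
  have hzc := mem_cutPlane_of_im_ne_zero hz
  obtain ⟨-, -, -, hc, -, hd, -⟩ := Mmon_bounds hg
  have hc' : (0 : ℝ) ≤ g 1 0 := by exact_mod_cast hc
  have hd' : (1 : ℝ) ≤ g 1 1 := by exact_mod_cast hd
  have hε : monSign g ^ 2 = 1 := by
    rcases monSign_eq hg with h | h <;> rw [h] <;> norm_num
  have hi := (hasDerivAt_integral_div_sub (integrableOn_logWeight hg) (measurable_mobius g)
    (fun y hy => mobius_mem hg ⟨hy.1.le, hy.2⟩) hzc).1
  rw [Lop_phi0_eq hg hzc, ← ofReal_inv, re_ofReal_mul]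
  have hre := integral_re hi
  simp only [RCLike.re_eq_complex_re] at hre
  rw [← hre, integral_cuspProfile_mul (by positivity), ← integral_const_mul, ← integral_const_mul]
  refine setIntegral_congr_fun measurableSet_Ioc fun y hy => ?_
  rw [re_ofReal_div_sub]
  have hsg : monSign g = (g 0 0 : ℝ) * g 1 1 - g 0 1 * g 1 0 := by
    unfold monSign; push_cast; rfl
  unfold logWeight
  have hden := (le_denom hg hy.1.le).1
  generalize hεe : monSign g = ε at *
  have hmob : mobius g y
      = g 0 1 / g 1 1 + ε / (g 1 1 : ℝ) ^ 2 * (y / (g 1 0 / g 1 1 * y + 1)) := by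
    have h1 : (g 1 0 : ℝ) * y + g 1 1 ≠ 0 := by linarith
    have h2 : (g 1 1 : ℝ) ≠ 0 := by linarith
    have h3 : (g 1 0 : ℝ) / g 1 1 * y + 1 = (g 1 0 * y + g 1 1) / g 1 1 := by field_simp
    rw [hsg, mobius, h3]
    obtain ⟨D, hD⟩ : ∃ D, D = (g 1 0 : ℝ) * y + g 1 1 := ⟨_, rfl⟩
    rw [← hD] at h1 ⊢
    field_simp
    rw [hD]
    ring
  rw [hmob]
  have h2 : (0 : ℝ) < g 1 1 := by linarith
  have h3 : (g 1 0 : ℝ) / g 1 1 * y + 1 = (g 1 0 * y + g 1 1) / g 1 1 := by field_simp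
  generalize hs : y / ((g 1 0 : ℝ) / g 1 1 * y + 1) = s
  have hk : conjKernel z.im (g 0 1 / g 1 1 + ε / (g 1 1 : ℝ) ^ 2 * s - z.re)
      = ε * (g 1 1 : ℝ) ^ 2 * conjKernel ((g 1 1 : ℝ) ^ 2 * z.im)
        (s - ε * ((g 1 1 : ℝ) ^ 2 * (z.re - g 0 1 / g 1 1))) := by
    generalize hu : s - ε * ((g 1 1 : ℝ) ^ 2 * (z.re - g 0 1 / g 1 1)) = u
    have hs' : (g 0 1 : ℝ) / g 1 1 + ε / (g 1 1 : ℝ) ^ 2 * s - z.re = ε * u / (g 1 1 : ℝ) ^ 2 := by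
      rw [← hu, mul_sub, ← mul_assoc ε ε, ← sq ε, hε]
      field_simp
      ring
    have hz2 : 0 < z.im ^ 2 := by positivity
    rw [hs', conjKernel, conjKernel, div_pow, mul_pow, hε]
    have : u ^ 2 + ((g 1 1 : ℝ) ^ 2 * z.im) ^ 2 ≠ 0 := by positivity
    have h4 : 1 * u ^ 2 / ((g 1 1 : ℝ) ^ 2) ^ 2 + z.im ^ 2
      = (u ^ 2 + ((g 1 1 : ℝ) ^ 2 * z.im) ^ 2) / (g 1 1 : ℝ) ^ 4 := by
      field_simp
    rw [h4]
    field_simp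
  rw [hk, h3]
  have := Real.pi_pos
  have h1 : (g 1 0 : ℝ) * y + g 1 1 ≠ 0 := by linarith
  field_simp

/-- Two summands with the same denominator, opposite orientations and aligned cusps cancel to
leading order. -/
lemma exists_re_Lop_add_Lop_le : ∃ C : ℝ, 0 ≤ C ∧ ∀ g ∈ Mmon, ∀ g' ∈ Mmon, ∀ z z' : ℂ,
    g' 1 1 = g 1 1 → monSign g' = -monSign g → z.im ≠ 0 → z'.im = z.im →
    z'.re - g' 0 1 / g' 1 1 = z.re - g 0 1 / g 1 1 →
    |(Lop g phi0 z).re + (Lop g' phi0 z').re|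
      ≤ C * (1 / (g 1 1 * (1 + (g 1 1 : ℝ) ^ 2 * |z.re - g 0 1 / g 1 1|))) := by
  obtain ⟨C, hC, h⟩ := exists_conjKernel_twoSidedProfile_le
  refine ⟨C, hC, fun g hg g' hg' z z' hd hε hz hz' hx => ?_⟩
  rw [re_Lop_phi0 hg hz, re_Lop_phi0 hg' (by rwa [hz']), hx, hε, hd, hz']
  obtain ⟨-, -, -, hc, hcd, hd1, -⟩ := Mmon_bounds hg
  obtain ⟨-, -, -, hc', hcd', hd1', -⟩ := Mmon_bounds hg'
  rw [hd] at hcd'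
  have hdR : (1 : ℝ) ≤ g 1 1 := by exact_mod_cast hd1
  have hd0 : (0 : ℝ) < g 1 1 := by linarith
  have b1 : 0 ≤ (g 1 0 : ℝ) / g 1 1 := div_nonneg (by exact_mod_cast hc) hd0.le
  have b2 : (g 1 0 : ℝ) / g 1 1 ≤ 1 := (div_le_one hd0).2 (by exact_mod_cast hcd)
  have b3 : 0 ≤ (g' 1 0 : ℝ) / g 1 1 := div_nonneg (by exact_mod_cast hc') hd0.le
  have b4 : (g' 1 0 : ℝ) / g 1 1 ≤ 1 := (div_le_one hd0).2 (by exact_mod_cast hcd')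
  set η := (g 1 1 : ℝ) ^ 2 * z.im
  have hη : η ≠ 0 := by positivity
  set ξ := monSign g * ((g 1 1 : ℝ) ^ 2 * (z.re - g 0 1 / g 1 1)) with hξ
  have hflip : ∫ s, cuspProfile (g' 1 0 / g 1 1) s * conjKernel η
        (s - -monSign g * ((g 1 1 : ℝ) ^ 2 * (z.re - g 0 1 / g 1 1)))
      = -∫ s, cuspProfile (g' 1 0 / g 1 1) (-s) * conjKernel η (s - ξ) := by
    rw [← integral_neg_eq_self, ← integral_neg]
    refine integral_congr_ae (ae_of_all _ fun s => ?_)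
    dsimp only
    rw [show -s - -monSign g * ((g 1 1 : ℝ) ^ 2 * (z.re - g 0 1 / g 1 1)) = -(s - ξ) by
      rw [hξ]; ring, conjKernel_neg, mul_neg]
  have hsum : (∫ s, cuspProfile (g 1 0 / g 1 1) s * conjKernel η (s - ξ))
      + ∫ s, cuspProfile (g' 1 0 / g 1 1) (-s) * conjKernel η (s - ξ)
      = ∫ s, twoSidedProfile (g 1 0 / g 1 1) (g' 1 0 / g 1 1) s * conjKernel η (s - ξ) := by
    rw [← integral_add (integrable_mul_conjKernel (integrable_cuspProfile b1 b2) hη ξ)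
      (integrable_mul_conjKernel (integrable_cuspProfile b3 b4).comp_neg hη ξ)]
    refine integral_congr_ae (ae_of_all _ fun s => ?_)
    dsimp only
    rw [twoSidedProfile]
    ring
  have hb := h _ _ ξ η b1 b2 b3 b4 hη
  rw [← hsum] at hb
  have hξ' : |ξ| = (g 1 1 : ℝ) ^ 2 * |z.re - g 0 1 / g 1 1| := by
    rw [hξ, abs_mul, abs_mul, abs_of_nonneg (by positivity : 0 ≤ (g 1 1 : ℝ) ^ 2)]
    rcases monSign_eq hg with h | h <;> rw [h] <;> simp
  rw [hξ'] at hb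
  rw [hflip]
  have e : ∀ A B : ℝ, monSign g / (Real.pi * g 1 1) * A + -monSign g / (Real.pi * g 1 1) * -B
      = monSign g / (Real.pi * g 1 1) * (A + B) := fun A B => by ring
  rw [e, abs_mul]
  have hp : |monSign g / (Real.pi * g 1 1)| ≤ 1 / g 1 1 := by
    have h1 : |monSign g| = 1 := by rcases monSign_eq hg with h | h <;> rw [h] <;> simp
    have := Real.pi_gt_three
    rw [abs_div, h1, abs_of_pos (by positivity)]
    gcongr
    nlinarith
  refine (mul_le_mul hp hb (abs_nonneg _) (by positivity)).trans (le_of_eq ?_)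
  field_simp

lemma Mmon_ext_of_cusp_eq {g g' : Matrix (Fin 2) (Fin 2) ℤ} (hg : g ∈ Mmon) (hg' : g' ∈ Mmon)
    (hdet : g 0 0 * g 1 1 - g 0 1 * g 1 0 = g' 0 0 * g' 1 1 - g' 0 1 * g' 1 0)
    (hcusp : g 0 1 * g' 1 1 = g' 0 1 * g 1 1) : g = g' := by
  obtain ⟨ha, hb, hbd, hc, hcd, hd, hs, hu⟩ := Mmon_bounds hg
  obtain ⟨ha', hb', hbd', hc', hcd', hd', hs', hu'⟩ := Mmon_bounds hg'
  have key : ∀ h ∈ Mmon, ∀ h' ∈ Mmon,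
      h 0 0 * h 1 1 - h 0 1 * h 1 0 = h' 0 0 * h' 1 1 - h' 0 1 * h' 1 0 →
      h 0 1 = h' 0 1 → h 1 1 = h' 1 1 → h 1 0 = h' 1 0 + h 1 1 → False := by
    intro h hh h' hh' e eb ed ec
    obtain ⟨-, -, -, -, hcd, hd, -⟩ := Mmon_bounds hh
    obtain ⟨-, -, -, hc', -, -, -⟩ := Mmon_bounds hh'
    have hc0 : h' 1 0 = 0 := by omega
    have h1 : h' = 1 := by
      by_contra hne
      have := Mmon_one_le hh' hne
      omega
    rcases hh with rfl | ⟨-, -, h3, h4, -⟩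
    · simp [h1] at ec
    · subst h1
      simp at eb ed e
      rw [eb, ed] at e
      omega
  have cop : ∀ h ∈ Mmon, IsCoprime (h 0 1) (h 1 1) := by
    intro h hh
    obtain ⟨-, -, -, -, -, -, -, e | e⟩ := Mmon_bounds hh
    · exact ⟨-h 1 0, h 0 0, by linarith⟩
    · exact ⟨h 1 0, -h 0 0, by linarith⟩
  have ed : g 1 1 = g' 1 1 := by
    apply Int.dvd_antisymm (by omega) (by omega)
    · exact (cop g hg).symm.dvd_of_dvd_mul_left ⟨g' 0 1, by rw [hcusp, mul_comm]⟩
    · exact (cop g' hg').symm.dvd_of_dvd_mul_left ⟨g 0 1, by rw [← hcusp, mul_comm]⟩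
  have eb : g 0 1 = g' 0 1 := by
    rw [← ed] at hcusp
    exact mul_right_cancel₀ (by omega) hcusp
  obtain ⟨m, hm⟩ : g 1 1 ∣ g 1 0 - g' 1 0 :=
    (cop g hg).symm.dvd_of_dvd_mul_left
      ⟨g 0 0 - g' 0 0, by rw [← eb, ← ed] at hdet; linear_combination -hdet⟩
  have hm1 : m < 2 := by nlinarith
  have hm2 : -2 < m := by nlinarith
  obtain h | h | h : m = -1 ∨ m = 0 ∨ m = 1 := by omega
  · subst h
    exact (key g' hg' g hg hdet.symm eb.symm ed.symm (by linarith)).elim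
  · subst h
    have ec : g 1 0 = g' 1 0 := by linarith
    have ea : g 0 0 = g' 0 0 := by
      rw [eb, ec, ← ed] at hdet
      exact mul_right_cancel₀ (b := g 1 1) (by omega) (by linarith)
    ext i j
    fin_cases i <;> fin_cases j <;> assumption
  · subst h
    exact (key g hg g' hg' hdet eb ed (by linarith)).elim

/-- Dyadic location of the cusp `b/d` of `g` relative to `x`, together with the orientation. -/
noncomputable def cuspIndex (x : ℝ) (g : Mmon) : (ℕ × ℤ) × Bool :=
  ((Nat.log 2 (g.1 1 1).toNat,
    ⌊4 * (4 : ℝ) ^ Nat.log 2 (g.1 1 1).toNat * ((g.1 0 1 : ℝ) / g.1 1 1 - x)⌋),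
    decide (g.1 0 0 * g.1 1 1 - g.1 0 1 * g.1 1 0 = 1))

lemma pow_log_denom (g : Mmon) :
    (2 : ℝ) ^ Nat.log 2 (g.1 1 1).toNat ≤ g.1 1 1 ∧
      (g.1 1 1 : ℝ) < 2 * 2 ^ Nat.log 2 (g.1 1 1).toNat := by
  obtain ⟨-, -, -, -, -, hd, -⟩ := Mmon_bounds g.2
  have e : ((g.1 1 1).toNat : ℝ) = g.1 1 1 := by
    have : (((g.1 1 1).toNat : ℤ) : ℝ) = g.1 1 1 := by rw [Int.toNat_of_nonneg (by omega)]
    exact_mod_cast this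
  constructor
  · rw [← e]
    exact_mod_cast Nat.pow_log_le_self 2 (by omega)
  · have := Nat.lt_pow_succ_log_self (b := 2) (by norm_num) (g.1 1 1).toNat
    rw [Nat.succ_eq_add_one, pow_succ, mul_comm] at this
    rw [← e]
    exact_mod_cast this

lemma cuspIndex_injective (x : ℝ) : Function.Injective (cuspIndex x) := by
  intro g g' h
  simp only [cuspIndex, Prod.mk.injEq, decide_eq_decide] at h
  obtain ⟨⟨hj, hk⟩, hε⟩ := h
  have p := pow_log_denom g
  have p' := pow_log_denom g'
  rw [← hj] at hk p'
  set j := Nat.log 2 (g.1 1 1).toNat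
  obtain ⟨-, -, -, -, -, hd, -, hu⟩ := Mmon_bounds g.2
  obtain ⟨-, -, -, -, -, hd', -, hu'⟩ := Mmon_bounds g'.2
  have h4 : (4 : ℝ) ^ j = 2 ^ j * 2 ^ j := by rw [← mul_pow]; norm_num
  have hj0 : (0 : ℝ) < 2 ^ j := by positivity
  have hclose := Int.abs_sub_lt_one_of_floor_eq_floor hk
  rw [← mul_sub, sub_sub_sub_cancel_right, abs_mul, abs_of_pos (by positivity), h4] at hclose
  have hdR : (0 : ℝ) < g.1 1 1 := by exact_mod_cast hd
  have hdR' : (0 : ℝ) < g'.1 1 1 := by exact_mod_cast hd'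
  apply Subtype.ext
  apply Mmon_ext_of_cusp_eq g.2 g'.2
  · rcases hu with h | h <;> rcases hu' with h' | h' <;> rw [h, h'] at hε ⊢ <;> simp at hε
  · by_contra hne
    have h1 : (1 : ℝ) ≤ |(g.1 0 1 : ℝ) * g'.1 1 1 - g'.1 0 1 * g.1 1 1| := by
      have := Int.one_le_abs (sub_ne_zero.2 hne)
      exact_mod_cast this
    have e : (g.1 0 1 : ℝ) / g.1 1 1 - g'.1 0 1 / g'.1 1 1
        = (g.1 0 1 * g'.1 1 1 - g'.1 0 1 * g.1 1 1) / (g.1 1 1 * g'.1 1 1) := by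
      field_simp
    rw [e, abs_div, abs_of_pos (by positivity : (0 : ℝ) < g.1 1 1 * g'.1 1 1), ← mul_div_assoc,
      div_lt_one (by positivity)] at hclose
    have h2 : (g.1 1 1 : ℝ) * g'.1 1 1 < (2 * 2 ^ j) * (2 * 2 ^ j) :=
      mul_lt_mul'' p.2 p'.2 hdR.le hdR'.le
    nlinarith [mul_pos hj0 hj0]

/-- A summable majorant in terms of the dyadic location of the cusp. -/
noncomputable def cuspBound (p : (ℕ × ℤ) × Bool) : ℝ :=
  ((1 / 2 : ℝ) ^ p.1.1) ^ (1 / 2 : ℝ) * (1 + |(p.1.2 : ℝ)|) ^ (-(5 / 4) : ℝ) * 1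

lemma summable_cuspBound : Summable cuspBound := by
  have h1 : Summable fun j : ℕ => ((1 / 2 : ℝ) ^ j) ^ (1 / 2 : ℝ) := by
    have : (fun j : ℕ => ((1 / 2 : ℝ) ^ j) ^ (1 / 2 : ℝ))
        = fun j : ℕ => ((1 / 2 : ℝ) ^ (1 / 2 : ℝ)) ^ j := by
      ext j
      rw [← Real.rpow_natCast, ← Real.rpow_natCast, ← Real.rpow_mul (by norm_num),
        ← Real.rpow_mul (by norm_num), mul_comm]
    rw [this]
    exact summable_geometric_of_lt_one (by positivity)
      (Real.rpow_lt_one (by norm_num) (by norm_num) (by norm_num))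
  have h2 : Summable fun k : ℤ => (1 + |(k : ℝ)|) ^ (-(5 / 4) : ℝ) := by
    refine Summable.of_norm_bounded_eventually
      (Real.summable_abs_int_rpow (b := 5 / 4) (by norm_num)) ?_
    filter_upwards [(finite_singleton (0 : ℤ)).compl_mem_cofinite] with k hk
    have : (0 : ℝ) < |(k : ℝ)| := abs_pos.2 (by exact_mod_cast hk)
    rw [Real.norm_of_nonneg (by positivity)]
    exact Real.rpow_le_rpow_of_nonpos this (by linarith) (by norm_num)
  have h3 : Summable fun p : ℕ × ℤ => ((1 / 2 : ℝ) ^ p.1) ^ (1 / 2 : ℝ)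
      * (1 + |(p.2 : ℝ)|) ^ (-(5 / 4) : ℝ) :=
    h1.mul_of_nonneg h2 (fun _ => by positivity) (fun _ => by positivity)
  exact h3.mul_of_nonneg (g := fun _ : Bool => (1 : ℝ)) (Summable.of_finite)
    (fun _ => by positivity) (fun _ => by simp)

/-- The size of the contribution of the cusp of `g` at the real point `x`. -/
noncomputable def cuspDecay (x : ℝ) (g : Mmon) : ℝ :=
  1 / (g.1 1 1 * (1 + (g.1 1 1 : ℝ) ^ 2 * |x - g.1 0 1 / g.1 1 1|))

lemma cuspDecay_nonneg (x : ℝ) (g : Mmon) : 0 ≤ cuspDecay x g := by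
  obtain ⟨-, -, -, -, -, hd, -⟩ := Mmon_bounds g.2
  have : (0 : ℝ) < g.1 1 1 := by exact_mod_cast hd
  unfold cuspDecay
  positivity

lemma cuspDecay_le {x : ℝ} (hx : |x| ≤ 4) (g : Mmon) :
    cuspDecay x g ≤ 88 * cuspBound (cuspIndex x g) := by
  obtain ⟨-, hb, hbd, -, -, hd, -⟩ := Mmon_bounds g.2
  have p := pow_log_denom g
  have hd0 : (0 : ℝ) < g.1 1 1 := by exact_mod_cast hd
  have hb0 : 0 ≤ (g.1 0 1 : ℝ) / g.1 1 1 := div_nonneg (by exact_mod_cast hb) hd0.le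
  have hb1 : (g.1 0 1 : ℝ) / g.1 1 1 ≤ 1 := (div_le_one hd0).2 (by exact_mod_cast hbd)
  simp only [cuspDecay, cuspBound, cuspIndex, mul_one]
  set j := Nat.log 2 (g.1 1 1).toNat
  set v := (g.1 0 1 : ℝ) / g.1 1 1 - x with hv
  set k := ⌊4 * (4 : ℝ) ^ j * v⌋ with hk
  have hu : |x - (g.1 0 1 : ℝ) / g.1 1 1| = |v| := by rw [hv, abs_sub_comm]
  rw [hu]
  have hv5 : |v| ≤ 5 := by
    rw [abs_le] at hx ⊢
    constructor <;> linarith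
  have hk1 : |(k : ℝ)| ≤ 4 * 4 ^ j * |v| + 1 := by
    have h1 := Int.floor_le (4 * (4 : ℝ) ^ j * v)
    have h2 := Int.lt_floor_add_one (4 * (4 : ℝ) ^ j * v)
    rw [← hk] at h1 h2
    have h3 : |4 * (4 : ℝ) ^ j * v| = 4 * 4 ^ j * |v| := by
      rw [abs_mul, abs_of_pos (by positivity)]
    rw [← h3]
    have := abs_sub_abs_le_abs_sub (k : ℝ) (4 * (4 : ℝ) ^ j * v)
    have h4 : |(k : ℝ) - 4 * (4 : ℝ) ^ j * v| ≤ 1 := by rw [abs_le]; constructor <;> linarith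
    linarith
  have h4 : (4 : ℝ) ^ j = 2 ^ j * 2 ^ j := by rw [← mul_pow]; norm_num
  have hj1 : (1 : ℝ) ≤ 2 ^ j := one_le_pow₀ (by norm_num)
  have hj0 : (0 : ℝ) < 2 ^ j := by positivity
  have hP : (1 : ℝ) ≤ 1 + |(k : ℝ)| := by linarith [abs_nonneg (k : ℝ)]
  have hbig : 1 + |(k : ℝ)| ≤ 22 * 4 ^ j := by
    have : (1 : ℝ) ≤ 4 ^ j := one_le_pow₀ (by norm_num)
    nlinarith
  have hroot : (1 + |(k : ℝ)|) ^ (1 / 4 : ℝ) ≤ 22 * ((2 : ℝ) ^ j) ^ (1 / 2 : ℝ) := by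
    refine (Real.rpow_le_rpow (by linarith) hbig (by norm_num)).trans ?_
    rw [Real.mul_rpow (by norm_num) (by positivity)]
    have e1 : (22 : ℝ) ^ (1 / 4 : ℝ) ≤ 22 := by
      conv_rhs => rw [← Real.rpow_one 22]
      exact Real.rpow_le_rpow_of_exponent_le (by norm_num) (by norm_num)
    have e2 : ((4 : ℝ) ^ j) ^ (1 / 4 : ℝ) = ((2 : ℝ) ^ j) ^ (1 / 2 : ℝ) := by
      rw [h4, ← sq, ← Real.rpow_natCast, ← Real.rpow_mul hj0.le]
      norm_num
    rw [e2]
    gcongr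
  have hdec : 1 / ((g.1 1 1 : ℝ) * (1 + (g.1 1 1 : ℝ) ^ 2 * |v|))
      ≤ 4 / (2 ^ j * (1 + |(k : ℝ)|)) := by
    rw [div_le_div_iff₀ (by positivity) (by positivity), one_mul]
    have h1 : (2 : ℝ) ^ j * 2 ^ j ≤ (g.1 1 1 : ℝ) ^ 2 := by nlinarith [p.1]
    have h2 : 1 + |(k : ℝ)| ≤ 4 * (1 + (g.1 1 1 : ℝ) ^ 2 * |v|) := by
      rw [h4] at hk1
      nlinarith [mul_le_mul_of_nonneg_right h1 (abs_nonneg v)]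
    calc (2 : ℝ) ^ j * (1 + |(k : ℝ)|)
        ≤ g.1 1 1 * (4 * (1 + (g.1 1 1 : ℝ) ^ 2 * |v|)) :=
          mul_le_mul p.1 h2 (by linarith) hd0.le
      _ = _ := by ring
  refine hdec.trans ?_
  have e3 : (1 + |(k : ℝ)|) ^ (-(5 / 4) : ℝ)
      = (1 + |(k : ℝ)|)⁻¹ * ((1 + |(k : ℝ)|) ^ (1 / 4 : ℝ))⁻¹ := by
    rw [← Real.rpow_neg_one, ← Real.rpow_neg (by linarith), ← Real.rpow_add (by linarith)]
    norm_num
  have e4 : ((1 / 2 : ℝ) ^ j) ^ (1 / 2 : ℝ) = ((2 : ℝ) ^ j)⁻¹ * ((2 : ℝ) ^ j) ^ (1 / 2 : ℝ) := by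
    have hinv : (1 / 2 : ℝ) ^ j = ((2 : ℝ) ^ j)⁻¹ := by rw [one_div, inv_pow]
    rw [hinv, Real.inv_rpow hj0.le]
    have : ((2 : ℝ) ^ j) ^ (1 / 2 : ℝ) * ((2 : ℝ) ^ j) ^ (1 / 2 : ℝ) = 2 ^ j := by
      rw [← Real.rpow_add hj0]; norm_num
    generalize ((2 : ℝ) ^ j) ^ (1 / 2 : ℝ) = r at this ⊢
    have h0 : r ≠ 0 := by
      rintro rfl
      rw [mul_zero] at this
      exact hj0.ne this
    rw [← this]
    field_simp
  rw [e3, e4]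
  set r := ((2 : ℝ) ^ j) ^ (1 / 2 : ℝ)
  set q := (1 + |(k : ℝ)|) ^ (1 / 4 : ℝ)
  have hq : 0 < q := by positivity
  have e5 : 88 * (((2 : ℝ) ^ j)⁻¹ * r * ((1 + |(k : ℝ)|)⁻¹ * q⁻¹))
      = (88 * r / q) / (2 ^ j * (1 + |(k : ℝ)|)) := by
    field_simp
  rw [e5]
  gcongr
  rw [le_div_iff₀ hq]
  linarith

lemma exists_tsum_cuspDecay_le : ∃ C : ℝ, ∀ x : ℝ, |x| ≤ 4 →
    Summable (cuspDecay x) ∧ ∑' g, cuspDecay x g ≤ C := by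
  refine ⟨88 * ∑' p, cuspBound p, fun x hx => ?_⟩
  have h0 : ∀ p, 0 ≤ cuspBound p := fun p => by unfold cuspBound; positivity
  have hW := summable_cuspBound.comp_injective (cuspIndex_injective x)
  have hs : Summable (cuspDecay x) :=
    Summable.of_nonneg_of_le (cuspDecay_nonneg x) (cuspDecay_le hx) (hW.mul_left 88)
  refine ⟨hs, (hs.tsum_le_tsum (cuspDecay_le hx) (hW.mul_left 88)).trans ?_⟩
  rw [tsum_mul_left]
  gcongr
  exact tsum_comp_le_tsum_of_inj summable_cuspBound h0 (cuspIndex_injective x)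

lemma summable_inv_denom_cube : Summable fun g : Mmon => 1 / (g.1 1 1 : ℝ) ^ 3 := by
  obtain ⟨C, hC⟩ := exists_tsum_cuspDecay_le
  refine Summable.of_nonneg_of_le (fun g => ?_) (fun g => ?_)
    ((hC 0 (by norm_num)).1.mul_left 2)
  · obtain ⟨-, -, -, -, -, hd, -⟩ := Mmon_bounds g.2
    have : (0 : ℝ) < g.1 1 1 := by exact_mod_cast hd
    positivity
  · obtain ⟨-, hb, hbd, -, -, hd, -⟩ := Mmon_bounds g.2
    have hd1 : (1 : ℝ) ≤ g.1 1 1 := by exact_mod_cast hd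
    have hd0 : (0 : ℝ) < g.1 1 1 := by linarith
    have hb0 : 0 ≤ (g.1 0 1 : ℝ) / g.1 1 1 := div_nonneg (by exact_mod_cast hb) hd0.le
    have hb1 : (g.1 0 1 : ℝ) / g.1 1 1 ≤ 1 := (div_le_one hd0).2 (by exact_mod_cast hbd)
    rw [cuspDecay, zero_sub, abs_neg, abs_of_nonneg hb0, mul_one_div,
      div_le_div_iff₀ (by positivity) (by positivity)]
    have : (1 : ℝ) + (g.1 1 1 : ℝ) ^ 2 * (g.1 0 1 / g.1 1 1) ≤ 2 * (g.1 1 1 : ℝ) ^ 2 := by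
      nlinarith
    nlinarith

/-- The element of `ℳ` paired with the identity. -/
def gOne : Matrix (Fin 2) (Fin 2) ℤ := !![0, 1; 1, 1]

lemma gOne_mem : gOne ∈ Mmon := Or.inr (by simp [gOne])

/-- The partner of `g`: the element of `ℳ` with the same cusp and opposite orientation. -/
def cuspPartner (g : Matrix (Fin 2) (Fin 2) ℤ) : Matrix (Fin 2) (Fin 2) ℤ :=
  if g = 1 ∨ g = gOne then g
  else !![g 0 1 - g 0 0, g 0 1; g 1 1 - g 1 0, g 1 1]

lemma cuspPartner_mem {g : Matrix (Fin 2) (Fin 2) ℤ} (hg : g ∈ Mmon) : cuspPartner g ∈ Mmon := by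
  unfold cuspPartner
  split_ifs with h
  · exact hg
  push Not at h
  obtain ⟨h1, h2⟩ := h
  obtain ⟨hc, hac⟩ := Mmon_one_le hg h1
  rcases hg with rfl | ⟨hdet, hbd, hab, ha, hcd, -⟩
  · exact absurd rfl h1
  refine Or.inr ⟨?_, ?_⟩
  · simp only [Matrix.of_apply, Matrix.cons_val', Matrix.cons_val_zero, Matrix.cons_val_one,
      Matrix.cons_val_fin_one]
    rcases hdet with h | h
    · right; linarith
    · left; linarith
  · simp only [Matrix.of_apply, Matrix.cons_val', Matrix.cons_val_zero, Matrix.cons_val_one,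
      Matrix.cons_val_fin_one]
    refine ⟨hbd, by omega, by omega, by omega, ?_⟩
    by_contra hlt
    have hb : 1 ≤ g 0 1 := by
      by_contra hb
      have hb0 : g 0 1 = 0 := by omega
      have ha0 : g 0 0 = 0 := by omega
      rw [hb0, ha0] at hdet
      omega
    have hp : 0 ≤ g 1 1 - g 0 1 := by omega
    have hq : 1 ≤ g 1 0 - g 0 0 - (g 1 1 - g 0 1) := by omega
    have e : g 0 1 * g 1 0 - g 0 0 * g 1 1
        = g 0 1 * (g 1 0 - g 0 0 - (g 1 1 - g 0 1))
          + (g 0 1 - g 0 0) * (g 1 1 - g 0 1) := by ring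
    have e1 : g 0 1 * g 1 0 - g 0 0 * g 1 1 ≤ 1 := by omega
    have hb1 : g 0 1 = 1 := by nlinarith [mul_nonneg (sub_nonneg.2 hab) hp]
    rw [hb1] at e
    have e2 : (1 - g 0 0) * (g 1 1 - 1) = 0 := by
      apply le_antisymm <;> nlinarith
    rcases mul_eq_zero.1 e2 with h0 | h0
    · rw [h0] at e
      omega
    · apply h2
      have hd : g 1 1 = 1 := by omega
      have hc1 : g 1 0 = 1 := by omega
      have ha0 : g 0 0 = 0 := by omega
      ext i j
      fin_cases i <;> fin_cases j <;> simpa [gOne]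

lemma cuspPartner_cuspPartner {g : Matrix (Fin 2) (Fin 2) ℤ} (hg : g ∈ Mmon) :
    cuspPartner (cuspPartner g) = g := by
  by_cases h : g = 1 ∨ g = gOne
  · simp only [cuspPartner, if_pos h]
  have e : cuspPartner g = !![g 0 1 - g 0 0, g 0 1; g 1 1 - g 1 0, g 1 1] := if_neg h
  have h' : ¬(cuspPartner g = 1 ∨ cuspPartner g = gOne) := by
    rw [e]
    push Not at h
    obtain ⟨hc, hac⟩ := Mmon_one_le hg h.1
    rcases hg with rfl | ⟨hdet, hbd, hab, ha, hcd, -⟩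
    · exact absurd rfl h.1
    rintro (h3 | h3)
    · have hb : g 0 1 = 0 := by simpa using congrFun (congrFun h3 0) 1
      have ha0 : g 0 0 = 0 := by omega
      rw [hb, ha0] at hdet
      omega
    · have hd : g 1 1 = 1 := by simpa [gOne] using congrFun (congrFun h3 1) 1
      have hd' : g 1 1 - g 1 0 = 1 := by simpa [gOne] using congrFun (congrFun h3 1) 0
      omega
  rw [cuspPartner, if_neg h', e]
  ext i j
  fin_cases i <;> fin_cases j <;> simp

/-- The pairing of `ℳ` as a permutation. -/
def cuspPerm : Equiv.Perm Mmon :=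
  Function.Involutive.toPerm (fun g => ⟨cuspPartner g.1, cuspPartner_mem g.2⟩)
    fun g => Subtype.ext (cuspPartner_cuspPartner g.2)

lemma cuspPerm_apply (g : Mmon) : (cuspPerm g).1 = cuspPartner g.1 := rfl

lemma norm_sub_one_le_segDist (z : ℂ) : ‖z‖ - 1 ≤ segDist z := by
  refine le_segDist fun x hx => ?_
  have h1 : ‖(x : ℂ)‖ ≤ 1 := by
    rw [Complex.norm_real, Real.norm_of_nonneg hx.1]; exact hx.2
  have := norm_sub_norm_le z (x : ℂ)
  rw [norm_sub_rev]
  linarith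

lemma mem_cutPlane_of_one_lt_norm {z : ℂ} (hz : 1 < ‖z‖) : z ∈ cutPlane 0 1 := by
  rintro ⟨x, hx, rfl⟩
  rw [Complex.norm_real, Real.norm_of_nonneg hx.1] at hz
  exact hz.not_ge hx.2

lemma integral_norm_logWeight_bound {g : Matrix (Fin 2) (Fin 2) ℤ} (hg : g ∈ Mmon) {f : ℝ → ℂ}
    {r : ℝ} (hf : ∀ y ∈ Ioc (0 : ℝ) 1, ‖f y‖ ≤ logWeight g y / r) :
    ‖(Real.pi : ℂ)⁻¹ * ∫ y in Ioc (0 : ℝ) 1, f y‖ ≤ summandMass g / r := by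
  have h := norm_integral_le_of_norm_le (μ := volume.restrict (Ioc 0 1)) (f := f)
    ((integrableOn_logWeight hg).div_const r)
    ((ae_restrict_iff' measurableSet_Ioc).2 (ae_of_all _ hf))
  rw [norm_mul, norm_inv, Complex.norm_real, Real.norm_of_nonneg Real.pi_pos.le, summandMass,
    mul_div_assoc]
  rw [integral_div] at h
  have := Real.pi_pos
  gcongr

lemma norm_Lop_phi0_le {g : Matrix (Fin 2) (Fin 2) ℤ} (hg : g ∈ Mmon) {z : ℂ}
    (hz : z ∈ cutPlane 0 1) : ‖Lop g phi0 z‖ ≤ summandMass g / segDist z := by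
  rw [Lop_phi0_eq hg hz]
  refine integral_norm_logWeight_bound hg fun y hy => ?_
  have h0 := segDist_pos hz
  have hw := (logWeight_bounds hg hy).1
  rw [norm_div, Complex.norm_real, Real.norm_of_nonneg hw]
  gcongr
  exact segDist_le (mobius_mem hg ⟨hy.1.le, hy.2⟩)

lemma norm_mul_Lop_phi0_add_le {g : Matrix (Fin 2) (Fin 2) ℤ} (hg : g ∈ Mmon) {z : ℂ}
    (hz : z ∈ cutPlane 0 1) :
    ‖z * Lop g phi0 z + summandMass g‖ ≤ summandMass g / segDist z := by
  have hi := (hasDerivAt_integral_div_sub (integrableOn_logWeight hg) (measurable_mobius g)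
    (fun y hy => mobius_mem hg ⟨hy.1.le, hy.2⟩) hz).1
  have hw : IntegrableOn (fun y => (logWeight g y : ℂ)) (Ioc 0 1) :=
    (integrableOn_logWeight hg).ofReal
  have e : z * Lop g phi0 z + summandMass g = (Real.pi : ℂ)⁻¹ * ∫ y in Ioc (0 : ℝ) 1,
      (z * ((logWeight g y : ℂ) / (mobius g y - z)) + logWeight g y) := by
    rw [integral_add (hi.const_mul z) hw, integral_const_mul, Lop_phi0_eq hg hz, summandMass,
      integral_complex_ofReal]
    push_cast
    ring
  rw [e]
  refine integral_norm_logWeight_bound hg fun y hy => ?_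
  have hm := mobius_mem hg ⟨hy.1.le, hy.2⟩
  have hne := sub_ne_zero_of_mem_cutPlane hz hm
  have h0 := segDist_pos hz
  have hl := (logWeight_bounds hg hy).1
  have e2 : z * ((logWeight g y : ℂ) / (mobius g y - z)) + logWeight g y
      = (logWeight g y * mobius g y : ℝ) / ((mobius g y : ℂ) - z) := by
    push_cast
    field_simp
    ring
  rw [e2, norm_div, Complex.norm_real, Real.norm_of_nonneg (mul_nonneg hl hm.1)]
  have := segDist_le (z := z) hm
  gcongr
  exact mul_le_of_le_one_right hl hm.2

lemma differentiableOn_Lop_phi0 {g : Matrix (Fin 2) (Fin 2) ℤ} (hg : g ∈ Mmon) :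
    DifferentiableOn ℂ (Lop g phi0) (cutPlane 0 1) := by
  have h : DifferentiableOn ℂ (fun z => (Real.pi : ℂ)⁻¹ *
      ∫ y in Ioc (0 : ℝ) 1, (logWeight g y : ℂ) / (mobius g y - z)) (cutPlane 0 1) :=
    fun z hz => ((hasDerivAt_integral_div_sub (integrableOn_logWeight hg) (measurable_mobius g)
      (fun y hy => mobius_mem hg ⟨hy.1.le, hy.2⟩) hz).2.2.const_mul
        _).differentiableAt.differentiableWithinAt
  exact h.congr fun z hz => Lop_phi0_eq hg hz

lemma summable_summandMass : Summable fun g : Mmon => summandMass g.1 :=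
  Summable.of_nonneg_of_le (fun g => summandMass_nonneg g.2) (fun g => summandMass_le g.2)
    summable_inv_denom_cube

lemma summable_Lop_phi0 {z : ℂ} (hz : z ∈ cutPlane 0 1) :
    Summable fun g : Mmon => Lop g.1 phi0 z :=
  Summable.of_norm_bounded (summable_summandMass.div_const (segDist z))
    fun g => norm_Lop_phi0_le g.2 hz

/-- Total mass of the densities of the family `L_g φ₀`. -/
noncomputable def totalMass : ℝ := ∑' g : Mmon, summandMass g.1

lemma totalMass_nonneg : 0 ≤ totalMass := tsum_nonneg fun g => summandMass_nonneg g.2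

lemma norm_sumM_phi0_le {z : ℂ} (hz : z ∈ cutPlane 0 1) :
    ‖sumM phi0 z‖ ≤ totalMass / segDist z :=
  tsum_of_norm_bounded (summable_summandMass.hasSum.div_const (segDist z))
    fun g => norm_Lop_phi0_le g.2 hz

lemma norm_mul_sumM_phi0_add_le {z : ℂ} (hz : z ∈ cutPlane 0 1) :
    ‖z * sumM phi0 z + totalMass‖ ≤ totalMass / segDist z := by
  have hm : Summable fun g : Mmon => (summandMass g.1 : ℂ) := by
    exact_mod_cast summable_summandMass
  rw [sumM, totalMass, Complex.ofReal_tsum, ← tsum_mul_left,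
    ← ((summable_Lop_phi0 hz).mul_left z).tsum_add hm]
  exact tsum_of_norm_bounded (summable_summandMass.hasSum.div_const (segDist z))
    fun g => norm_mul_Lop_phi0_add_le g.2 hz

lemma exists_pos_le_segDist {K : Set ℂ} (hK : IsCompact K) (hK' : K ⊆ cutPlane 0 1) :
    ∃ δ > 0, ∀ z ∈ K, δ ≤ segDist z := by
  rcases K.eq_empty_or_nonempty with rfl | hne
  · exact ⟨1, one_pos, by simp⟩
  obtain ⟨w, hw, hmin⟩ := hK.exists_isMinOn hne continuous_segDist.continuousOn
  exact ⟨segDist w, segDist_pos (hK' hw), fun z hz => hmin hz⟩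

lemma summable_iSup_Lop_phi0 {K : Set ℂ} (hK : IsCompact K) (hK' : K ⊆ cutPlane 0 1) :
    Summable fun g : Mmon => ⨆ z ∈ K, ‖Lop g.1 phi0 z‖ := by
  obtain ⟨δ, hδ, h⟩ := exists_pos_le_segDist hK hK'
  refine Summable.of_nonneg_of_le
    (fun g => Real.iSup_nonneg fun z => Real.iSup_nonneg fun _ => norm_nonneg _) (fun g => ?_)
    (summable_summandMass.div_const δ)
  have h0 := summandMass_nonneg g.2
  have h1 : 0 ≤ summandMass g.1 / δ := by positivity
  refine Real.iSup_le (fun z => Real.iSup_le (fun hz => ?_) h1) h1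
  refine (norm_Lop_phi0_le g.2 (hK' hz)).trans ?_
  gcongr
  exact h z hz

lemma differentiableOn_sumM_phi0 : DifferentiableOn ℂ (sumM phi0) (cutPlane 0 1) := by
  intro z hz
  have hU : IsOpen {w | segDist z / 2 < segDist w} := isOpen_lt continuous_const continuous_segDist
  have h0 := segDist_pos hz
  have hsub : {w | segDist z / 2 < segDist w} ⊆ cutPlane 0 1 := by
    rintro w hw ⟨x, hx, rfl⟩
    have h1 := segDist_le (z := (x : ℂ)) hx
    rw [sub_self, norm_zero] at h1
    have h2 : segDist z / 2 < segDist (x : ℂ) := hw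
    linarith
  have h := Complex.differentiableOn_tsum_of_summable_norm
    (F := fun (g : Mmon) w => Lop g.1 phi0 w) (summable_summandMass.div_const (segDist z / 2))
    (fun g => (differentiableOn_Lop_phi0 g.2).mono hsub) hU fun g w hw => by
      refine (norm_Lop_phi0_le g.2 (hsub hw)).trans ?_
      have := summandMass_nonneg g.2
      have h2 : segDist z / 2 < segDist w := hw
      gcongr
  exact (h.differentiableAt (hU.mem_nhds (half_lt_self h0))).differentiableWithinAt

lemma tendsto_totalMass_div {α : Type*} {l : Filter α} {f : α → ℝ} (hf : Tendsto f l atTop) :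
    Tendsto (fun x => totalMass / (f x - 1)) l (𝓝 0) :=
  (tendsto_atTop_add_const_right l (-1) hf).const_div_atTop totalMass

lemma sumM_phi0_mem_O1 : sumM phi0 ∈ O1 0 1 := by
  refine ⟨differentiableOn_sumM_phi0, ?_⟩
  refine squeeze_zero_norm' ?_ (tendsto_totalMass_div (tendsto_norm_cobounded_atTop (E := ℂ)))
  filter_upwards [(tendsto_norm_cobounded_atTop (E := ℂ)).eventually_gt_atTop 1] with z hz
  refine (norm_sumM_phi0_le (mem_cutPlane_of_one_lt_norm hz)).trans ?_
  have := totalMass_nonneg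
  exact div_le_div_of_nonneg_left this (by linarith) (norm_sub_one_le_segDist z)

lemma tendsto_mul_sumM_phi0 :
    Tendsto (fun y : ℝ => Complex.I * (y : ℂ) * sumM phi0 (Complex.I * (y : ℂ))) atTop
      (𝓝 ((-totalMass : ℝ) : ℂ)) := by
  rw [tendsto_iff_norm_sub_tendsto_zero]
  refine squeeze_zero' (Eventually.of_forall fun _ => norm_nonneg _) ?_
    (tendsto_totalMass_div tendsto_id)
  filter_upwards [eventually_gt_atTop 1] with y hy
  have hn : ‖Complex.I * (y : ℂ)‖ = y := by
    rw [norm_mul, Complex.norm_I, one_mul, Complex.norm_real, Real.norm_of_nonneg (by linarith)]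
  have h := norm_mul_sumM_phi0_add_le (mem_cutPlane_of_one_lt_norm (hn.symm ▸ hy))
  rw [ofReal_neg, sub_neg_eq_add]
  refine h.trans (div_le_div_of_nonneg_left totalMass_nonneg (sub_pos.2 hy) ?_)
  have := norm_sub_one_le_segDist (Complex.I * (y : ℂ))
  rwa [hn] at this

/-- The term of the series defining the complex Brjuno function. -/
noncomputable def brjTerm (z : ℂ) : ℂ :=
  sumM phi0 z - ((-totalMass : ℝ) : ℂ) * Complex.log (z / (z - 1))

lemma norm_log_div_sub_one_le {z : ℂ} (hz : 2 ≤ ‖z‖) :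
    ‖Complex.log (z / (z - 1)) - z⁻¹‖ ≤ 1 / ‖z‖ ^ 2 := by
  have hz0 : z ≠ 0 := norm_pos_iff.1 (by linarith)
  have hw : ‖-z⁻¹‖ ≤ 1 / 2 := by
    rw [norm_neg, norm_inv, ← one_div]
    exact one_div_le_one_div_of_le (by norm_num) hz
  have hre : 0 < (1 + -z⁻¹).re := by
    have := (Complex.abs_re_le_norm (-z⁻¹)).trans hw
    rw [abs_le] at this
    rw [add_re, one_re]
    linarith
  have e : z / (z - 1) = (1 + -z⁻¹)⁻¹ := by
    rw [show 1 + -z⁻¹ = (z - 1) / z by field_simp; ring, inv_div]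
  have harg : (1 + -z⁻¹).arg ≠ Real.pi := by
    intro h
    rw [Complex.arg_eq_pi_iff] at h
    linarith [h.1]
  have h := Complex.norm_log_one_add_sub_self_le (z := -z⁻¹) (by linarith)
  rw [e, Complex.log_inv _ harg, show -Complex.log (1 + -z⁻¹) - z⁻¹
    = -(Complex.log (1 + -z⁻¹) - -z⁻¹) by ring, norm_neg]
  refine h.trans ?_
  have h2 : (1 - ‖-z⁻¹‖)⁻¹ ≤ 2 := by
    rw [inv_le_comm₀ (by linarith) (by norm_num)]
    linarith
  calc ‖-z⁻¹‖ ^ 2 * (1 - ‖-z⁻¹‖)⁻¹ / 2 ≤ ‖-z⁻¹‖ ^ 2 * 2 / 2 := by gcongr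
    _ = 1 / ‖z‖ ^ 2 := by rw [norm_neg, norm_inv]; field_simp

lemma norm_brjTerm_le {z : ℂ} (hz : 2 ≤ ‖z‖) : ‖brjTerm z‖ ≤ 3 * totalMass / ‖z‖ ^ 2 := by
  have hz0 : z ≠ 0 := norm_pos_iff.1 (by linarith)
  have hA := totalMass_nonneg
  have h1 := norm_mul_sumM_phi0_add_le (mem_cutPlane_of_one_lt_norm (by linarith : 1 < ‖z‖))
  have h2 := norm_log_div_sub_one_le hz
  have h3 := norm_sub_one_le_segDist z
  have e : brjTerm z = (z * sumM phi0 z + totalMass) / z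
      + totalMass * (Complex.log (z / (z - 1)) - z⁻¹) := by
    rw [brjTerm]
    push_cast
    field_simp
    ring
  have hle : ‖z * sumM phi0 z + totalMass‖ ≤ 2 * totalMass / ‖z‖ := by
    refine h1.trans ?_
    rw [div_le_div_iff₀ (by linarith) (by linarith)]
    nlinarith
  rw [e]
  refine (norm_add_le _ _).trans ?_
  rw [norm_div, norm_mul, Complex.norm_real, Real.norm_of_nonneg hA]
  calc ‖z * sumM phi0 z + totalMass‖ / ‖z‖ + totalMass * ‖Complex.log (z / (z - 1)) - z⁻¹‖
      ≤ 2 * totalMass / ‖z‖ / ‖z‖ + totalMass * (1 / ‖z‖ ^ 2) := by gcongr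
    _ = 3 * totalMass / ‖z‖ ^ 2 := by field_simp; ring

lemma norm_brjTerm_sub_int_le {z : ℂ} {n : ℤ} (h2 : 2 ≤ ‖z - n‖) (hn : |(n : ℝ)| / 2 ≤ ‖z - n‖)
    (hn0 : n ≠ 0) : ‖brjTerm (z - n)‖ ≤ 12 * totalMass * (1 / (n : ℝ) ^ 2) := by
  refine (norm_brjTerm_le h2).trans ?_
  have hp : (0 : ℝ) < |(n : ℝ)| := abs_pos.2 (by exact_mod_cast hn0)
  have hA := totalMass_nonneg
  rw [← sq_abs (n : ℝ)]
  calc 3 * totalMass / ‖z - n‖ ^ 2 ≤ 3 * totalMass / (|(n : ℝ)| / 2) ^ 2 := by gcongr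
    _ = 12 * totalMass * (1 / |(n : ℝ)| ^ 2) := by field_simp; ring

lemma summable_iSup_brjTerm {K : Set ℂ} (hK : IsCompact K) :
    Summable fun n : ℤ => ⨆ z ∈ K, ‖brjTerm (z - n)‖ := by
  obtain ⟨R, hR⟩ := hK.isBounded.exists_norm_le
  have hs : Summable fun n : ℤ => 12 * totalMass * (1 / (n : ℝ) ^ 2) :=
    (Real.summable_one_div_int_pow.2 one_lt_two).mul_left _
  refine Summable.of_norm_bounded_eventually hs ?_
  filter_upwards [(finite_Icc (-(⌈2 * |R| + 4⌉)) ⌈2 * |R| + 4⌉).compl_mem_cofinite] with n hn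
  have hbig : 2 * |R| + 4 ≤ |(n : ℝ)| := by
    by_contra hlt
    push Not at hlt
    rw [abs_lt] at hlt
    have := Int.le_ceil (2 * |R| + 4)
    refine hn ⟨?_, ?_⟩
    · have : ((-⌈2 * |R| + 4⌉ : ℤ) : ℝ) ≤ n := by push_cast; linarith
      exact_mod_cast this
    · have : (n : ℝ) ≤ ⌈2 * |R| + 4⌉ := by linarith
      exact_mod_cast this
  have h0 : 0 ≤ 12 * totalMass * (1 / (n : ℝ) ^ 2) := by
    have := totalMass_nonneg
    positivity
  rw [Real.norm_of_nonneg
    (Real.iSup_nonneg fun z => Real.iSup_nonneg fun _ => norm_nonneg _)]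
  refine Real.iSup_le (fun z => Real.iSup_le (fun hz => ?_) h0) h0
  have h1 : |(n : ℝ)| - |R| ≤ ‖z - n‖ := by
    have h2 := norm_sub_norm_le (n : ℂ) z
    rw [norm_sub_rev, Complex.norm_intCast] at h2
    have := (hR z hz).trans (le_abs_self R)
    linarith
  have := abs_nonneg R
  exact norm_brjTerm_sub_int_le (by linarith) (by linarith) (by rintro rfl; simp at hbig; linarith)

lemma le_biSup_norm {f : ℂ → ℂ} {K : Set ℂ} (hK : IsCompact K) (hf : ContinuousOn f K) {z : ℂ}
    (hz : z ∈ K) : ‖f z‖ ≤ ⨆ w ∈ K, ‖f w‖ := by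
  obtain ⟨M, hM⟩ := hK.exists_bound_of_continuousOn hf
  have h1 : BddAbove (range fun w => ⨆ (_ : w ∈ K), ‖f w‖) := by
    refine ⟨|M|, ?_⟩
    rintro _ ⟨w, rfl⟩
    exact Real.iSup_le (fun hw => (hM w hw).trans (le_abs_self M)) (abs_nonneg M)
  have h2 : ‖f z‖ ≤ ⨆ (_ : z ∈ K), ‖f z‖ :=
    le_ciSup (f := fun _ : z ∈ K => ‖f z‖) ⟨‖f z‖, by rintro _ ⟨_, rfl⟩; exact le_rfl⟩ hz
  exact h2.trans (le_ciSup h1 z)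

lemma differentiableOn_brjTerm : DifferentiableOn ℂ brjTerm {z : ℂ | 0 < z.im} := by
  intro z hz
  have hz' : 0 < z.im := hz
  have hne : z - 1 ≠ 0 := by
    intro h
    have := congrArg Complex.im h
    simp at this
    linarith
  have hslit : z / (z - 1) ∈ slitPlane := by
    refine Complex.mem_slitPlane_iff.2 (Or.inr ?_)
    have e : z / (z - 1) = 1 + (z - 1)⁻¹ := by field_simp; ring
    rw [e, add_im, one_im, zero_add, inv_im]
    have : 0 < Complex.normSq (z - 1) := Complex.normSq_pos.2 hne
    simp only [sub_im, one_im, sub_zero]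
    exact div_ne_zero (neg_ne_zero.2 hz'.ne') this.ne'
  have h1 : DifferentiableAt ℂ (sumM phi0) z := differentiableOn_sumM_phi0.differentiableAt
    (isOpen_cutPlane.mem_nhds (mem_cutPlane_of_im_ne_zero hz'.ne'))
  have h2 : DifferentiableAt ℂ (fun z : ℂ => z / (z - 1)) z :=
    differentiableAt_id.div (differentiableAt_id.sub_const 1) hne
  have h3 : DifferentiableAt ℂ (fun z : ℂ => Complex.log (z / (z - 1))) z := h2.clog hslit
  have h4 : DifferentiableAt ℂ brjTerm z := by
    unfold brjTerm
    exact h1.sub (h3.const_mul _)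
  exact h4.differentiableWithinAt

lemma summable_brjTerm (z : ℂ) : Summable fun n : ℤ => ‖brjTerm (z - n)‖ :=
  Summable.of_nonneg_of_le (fun _ => norm_nonneg _)
    (fun n => le_biSup_norm (f := fun w => brjTerm (w - n)) isCompact_singleton
      (continuousOn_singleton _ _) (mem_singleton z))
    (summable_iSup_brjTerm isCompact_singleton)

lemma differentiableOn_tsum_brjTerm :
    DifferentiableOn ℂ (fun z => ∑' n : ℤ, brjTerm (z - n)) {z : ℂ | 0 < z.im} := by
  intro z hz
  have hz' : 0 < z.im := hz
  have hopen : IsOpen {z : ℂ | 0 < z.im} := isOpen_lt continuous_const Complex.continuous_im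
  obtain ⟨r, hr, hsub⟩ := Metric.nhds_basis_closedBall.mem_iff.1 (hopen.mem_nhds hz)
  have hd : ∀ n : ℤ, DifferentiableOn ℂ (fun w : ℂ => brjTerm (w - n)) (Metric.closedBall z r) :=
    fun n => differentiableOn_brjTerm.comp (differentiableOn_id.sub_const _) fun w hw => by
      have : 0 < w.im := hsub hw
      simpa using this
  have h := Complex.differentiableOn_tsum_of_summable_norm
    (F := fun (n : ℤ) (w : ℂ) => brjTerm (w - n))
    (summable_iSup_brjTerm (isCompact_closedBall z r))
    (fun n => (hd n).mono Metric.ball_subset_closedBall) Metric.isOpen_ball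
    (fun n w hw => le_biSup_norm (f := fun w => brjTerm (w - n)) (isCompact_closedBall z r)
      (hd n).continuousOn (Metric.ball_subset_closedBall hw))
  exact (h.differentiableAt (Metric.ball_mem_nhds z hr)).differentiableWithinAt

lemma BrjWith_eq (z : ℂ) : BrjWith ((-totalMass : ℝ) : ℂ) z
    = -Complex.I * (Real.pi : ℂ) * ((-totalMass : ℝ) : ℂ) + ∑' n : ℤ, brjTerm (z - n) := rfl

lemma BrjWith_add_int (z : ℂ) (m : ℤ) :
    BrjWith ((-totalMass : ℝ) : ℂ) (z + m) = BrjWith ((-totalMass : ℝ) : ℂ) z := by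
  rw [BrjWith_eq, BrjWith_eq, ← (Equiv.addRight m).tsum_eq fun n : ℤ => brjTerm (z + m - n)]
  congr 2
  ext n
  rw [Equiv.coe_addRight]
  push_cast
  congr 1
  ring

lemma abs_re_Lop_add_cuspPerm_le {C : ℝ}
    (hC : ∀ g ∈ Mmon, ∀ g' ∈ Mmon, ∀ z z' : ℂ, g' 1 1 = g 1 1 → monSign g' = -monSign g →
      z.im ≠ 0 → z'.im = z.im → z'.re - g' 0 1 / g' 1 1 = z.re - g 0 1 / g 1 1 →
      |(Lop g phi0 z).re + (Lop g' phi0 z').re|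
        ≤ C * (1 / (g 1 1 * (1 + (g 1 1 : ℝ) ^ 2 * |z.re - g 0 1 / g 1 1|))))
    {z : ℂ} (hz : z.im ≠ 0) {g : Mmon} (hg : ¬(g.1 = 1 ∨ g.1 = gOne)) :
    |(Lop g.1 phi0 z).re + (Lop (cuspPerm g).1 phi0 z).re| ≤ C * cuspDecay z.re g := by
  have e : cuspPartner g.1 = !![g.1 0 1 - g.1 0 0, g.1 0 1; g.1 1 1 - g.1 1 0, g.1 1 1] :=
    if_neg hg
  have h01 : cuspPartner g.1 0 1 = g.1 0 1 := by rw [e]; simp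
  have h11 : cuspPartner g.1 1 1 = g.1 1 1 := by rw [e]; simp
  refine hC g.1 g.2 _ (cuspPerm g).2 z z ?_ ?_ hz rfl ?_
  · rw [cuspPerm_apply, h11]
  · rw [cuspPerm_apply, e, monSign, monSign]
    simp
    ring
  · rw [cuspPerm_apply, h11, h01]

lemma cuspPerm_exceptional_iff (g : Mmon) :
    ((cuspPerm g).1 = 1 ∨ (cuspPerm g).1 = gOne) ↔ (g.1 = 1 ∨ g.1 = gOne) := by
  constructor
  · intro h
    have h2 : cuspPartner (cuspPartner g.1) = cuspPartner g.1 := if_pos h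
    rw [cuspPartner_cuspPartner g.2] at h2
    rw [cuspPerm_apply, ← h2] at h
    exact h
  · intro h
    rw [cuspPerm_apply, cuspPartner, if_pos h]
    exact h

lemma gOne_ne_one : gOne ≠ 1 := fun h => by
  have := congrFun (congrFun h 0) 0
  simp [gOne] at this

lemma one_mem_Mmon : (1 : Matrix (Fin 2) (Fin 2) ℤ) ∈ Mmon := Or.inl rfl

lemma exists_re_sumM_sub_le : ∃ C : ℝ, ∀ z : ℂ, z.im ≠ 0 → |z.re| ≤ 4 →
    |(sumM phi0 z).re - ((Lop 1 phi0 z).re + (Lop gOne phi0 z).re)| ≤ C := by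
  obtain ⟨C, hC0, hC⟩ := exists_re_Lop_add_Lop_le
  obtain ⟨D, hD⟩ := exists_tsum_cuspDecay_le
  refine ⟨C * D / 2, fun z hz hx => ?_⟩
  classical
  set f : Mmon → ℝ := fun g => (Lop g.1 phi0 z).re with hf
  have hsf : HasSum f (sumM phi0 z).re :=
    Complex.hasSum_re (summable_Lop_phi0 (mem_cutPlane_of_im_ne_zero hz)).hasSum
  set p : Mmon → Prop := fun g => g.1 = 1 ∨ g.1 = gOne with hp
  set F : Mmon → ℝ := fun g => if p g then 0 else f g with hF
  set i₁ : Mmon := ⟨1, one_mem_Mmon⟩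
  set i₂ : Mmon := ⟨gOne, gOne_mem⟩
  have hi : i₁ ≠ i₂ := fun h => gOne_ne_one (congrArg Subtype.val h).symm
  have hE : HasSum (fun g => if p g then f g else 0) (f i₁ + f i₂) := by
    have h : HasSum (fun g => if p g then f g else 0)
        (∑ g ∈ {i₁, i₂}, if p g then f g else 0) :=
      hasSum_sum_of_ne_finset_zero fun g hg => if_neg fun hpg => hg (by
        rcases hpg with h | h
        · exact Finset.mem_insert.2 (Or.inl (Subtype.ext h))
        · exact Finset.mem_insert.2 (Or.inr (Finset.mem_singleton.2 (Subtype.ext h))))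
    rw [Finset.sum_pair hi, if_pos (Or.inl rfl), if_pos (Or.inr rfl)] at h
    exact h
  have hsF : HasSum F ((sumM phi0 z).re - (f i₁ + f i₂)) := by
    refine (hsf.sub hE).congr_fun ?_
    intro g
    by_cases h : p g <;> simp [hF, h]
  have h2 := hsF.add ((Equiv.hasSum_iff cuspPerm).2 hsF)
  obtain ⟨hds, hdl⟩ := hD z.re hx
  have hb : ∀ g, ‖F g + (F ∘ cuspPerm) g‖ ≤ C * cuspDecay z.re g := by
    intro g
    have hn := cuspDecay_nonneg z.re g
    by_cases h : p g
    · have h' : p (cuspPerm g) := (cuspPerm_exceptional_iff g).2 h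
      simp only [hF, Function.comp, if_pos h, if_pos h', add_zero, norm_zero]
      positivity
    · have h' : ¬p (cuspPerm g) := fun h' => h ((cuspPerm_exceptional_iff g).1 h')
      simp only [hF, Function.comp, if_neg h, if_neg h']
      exact abs_re_Lop_add_cuspPerm_le hC hz h
  have h3 := tsum_of_norm_bounded (hds.hasSum.mul_left C) hb
  rw [h2.tsum_eq, Real.norm_eq_abs, ← two_mul, abs_mul, abs_two] at h3
  have h4 : C * ∑' g, cuspDecay z.re g ≤ C * D := by gcongr
  have h5 := h3.trans h4
  change |(sumM phi0 z).re - (f i₁ + f i₂)| ≤ C * D / 2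
  linarith

lemma abs_log_norm_sub_log_norm_le {a b : ℂ} (ha : 1 ≤ ‖a‖) (hb : 1 ≤ ‖b‖) :
    |Real.log ‖a‖ - Real.log ‖b‖| ≤ ‖a - b‖ := by
  have key : ∀ {a b : ℂ}, 1 ≤ ‖a‖ → 1 ≤ ‖b‖ → Real.log ‖a‖ - Real.log ‖b‖ ≤ ‖a - b‖ := by
    intro a b ha hb
    rw [← Real.log_div (by linarith) (by linarith)]
    refine (Real.log_le_sub_one_of_pos (by positivity)).trans ?_
    rw [sub_le_iff_le_add, div_le_iff₀ (by linarith)]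
    have h1 := norm_sub_norm_le a b
    nlinarith [norm_nonneg (a - b)]
  rw [abs_le]
  have h1 := key ha hb
  have h2 := key hb ha
  rw [norm_sub_rev] at h2
  constructor <;> linarith

lemma abs_re_Lop_phi0_le_two {g : Matrix (Fin 2) (Fin 2) ℤ} (hg : g ∈ Mmon) (hd : g 1 1 = 1)
    {z : ℂ} (hz : z.im ≠ 0) (hs : 1 / 2 ≤ segDist z) : |(Lop g phi0 z).re| ≤ 2 := by
  have h1 := norm_Lop_phi0_le hg (mem_cutPlane_of_im_ne_zero hz)
  have h2 := summandMass_le hg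
  rw [hd, Int.cast_one, one_pow, div_one] at h2
  refine ((Complex.abs_re_le_norm _).trans h1).trans ?_
  rw [div_le_iff₀ (by linarith)]
  linarith

lemma half_le_segDist {z : ℂ} (hz : 3 / 2 ≤ z.re ∨ z.re ≤ -(3 / 2)) : 1 / 2 ≤ segDist z := by
  refine le_segDist fun x hx => ?_
  refine le_trans ?_ (Complex.abs_re_le_norm _)
  rw [sub_re, ofReal_re]
  rcases hz with h | h
  · rw [abs_of_nonpos (by linarith [hx.2])]
    linarith [hx.2]
  · rw [abs_of_nonneg (by linarith [hx.1])]
    linarith [hx.1]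

lemma re_brjTerm {z : ℂ} (hz : z.im ≠ 0) : (brjTerm z).re
    = (sumM phi0 z).re + totalMass * (Real.log ‖z‖ - Real.log ‖z - 1‖) := by
  have h0 : ‖z‖ ≠ 0 := norm_ne_zero_iff.2 fun h => hz (by simp [h])
  have h1 : ‖z - 1‖ ≠ 0 := norm_ne_zero_iff.2 fun h => hz (by simpa using congrArg Complex.im h)
  rw [brjTerm, sub_re, re_ofReal_mul, Complex.log_re, norm_div, Real.log_div h0 h1]
  ring

lemma exists_abs_re_sum_brjTerm_le : ∃ C : ℝ, ∀ z : ℂ, z.im ≠ 0 → |z.re| ≤ 1 / 2 →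
    |∑ n ∈ ({-2, -1, 0, 1, 2} : Finset ℤ), (brjTerm (z - n)).re| ≤ C := by
  obtain ⟨C, hC⟩ := exists_re_sumM_sub_le
  obtain ⟨D, hD0, hD⟩ := exists_re_Lop_add_Lop_le
  refine ⟨5 * C + 4 * D + 4 + totalMass * 5, fun z hz hx => ?_⟩
  have hx' := abs_le.1 hx
  have hR : ∀ n : ℤ, |(n : ℝ)| ≤ 2 → |(sumM phi0 (z - n)).re
      - ((Lop 1 phi0 (z - n)).re + (Lop gOne phi0 (z - n)).re)| ≤ C := fun n hn => by
    refine hC _ (by simpa using hz) ?_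
    rw [sub_re, intCast_re]
    refine (abs_sub _ _).trans ?_
    linarith
  have hpair : ∀ n m : ℤ, n = m + 1 →
      |(Lop 1 phi0 (z - n)).re + (Lop gOne phi0 (z - m)).re| ≤ D := by
    rintro n m rfl
    refine (hD 1 one_mem_Mmon gOne gOne_mem (z - (m + 1 : ℤ)) (z - m) ?_ ?_ ?_ ?_ ?_).trans ?_
    · simp [gOne]
    · simp [monSign, gOne]
    · simpa using hz
    · simp
    · simp [gOne]
      ring
    · refine mul_le_of_le_one_right hD0 ?_
      simp only [Matrix.one_apply_eq, Int.cast_one, one_mul, one_pow]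
      rw [div_le_one (by positivity)]
      linarith [abs_nonneg ((z - ((m + 1 : ℤ) : ℂ)).re
        - ((1 : Matrix (Fin 2) (Fin 2) ℤ) 0 1 : ℝ) / 1)]
  have hl1 : |(Lop 1 phi0 (z - (-2 : ℤ))).re| ≤ 2 := by
    refine abs_re_Lop_phi0_le_two one_mem_Mmon (by simp) (by simpa using hz)
      (half_le_segDist (Or.inl ?_))
    simp
    linarith
  have hl2 : |(Lop gOne phi0 (z - (2 : ℤ))).re| ≤ 2 := by
    refine abs_re_Lop_phi0_le_two gOne_mem (by simp [gOne]) (by simpa using hz)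
      (half_le_segDist (Or.inr ?_))
    simp
    linarith
  have hlog : |Real.log ‖z - (-2 : ℤ)‖ - Real.log ‖z - (2 : ℤ) - 1‖| ≤ 5 := by
    refine (abs_log_norm_sub_log_norm_le ?_ ?_).trans ?_
    · refine le_trans ?_ (Complex.re_le_norm _)
      simp
      linarith
    · refine le_trans ?_ (Complex.abs_re_le_norm _)
      refine le_trans ?_ (neg_le_abs _)
      simp
      linarith
    · rw [show z - (-2 : ℤ) - (z - (2 : ℤ) - 1) = ((5 : ℝ) : ℂ) by push_cast; ring,
        Complex.norm_real]
      norm_num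
  have hlog' : |totalMass * (Real.log ‖z - (-2 : ℤ)‖ - Real.log ‖z - (2 : ℤ) - 1‖)|
      ≤ totalMass * 5 := by
    rw [abs_mul, abs_of_nonneg totalMass_nonneg]
    exact mul_le_mul_of_nonneg_left hlog totalMass_nonneg
  have hr : ∀ n : ℤ, (brjTerm (z - n)).re = (sumM phi0 (z - n)).re
      + totalMass * (Real.log ‖z - n‖ - Real.log ‖z - (n + 1 : ℤ)‖) := fun n => by
    rw [re_brjTerm (by simpa using hz)]
    push_cast
    rw [sub_sub]
  rw [Finset.sum_insert (by decide), Finset.sum_insert (by decide), Finset.sum_insert (by decide),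
    Finset.sum_insert (by decide), Finset.sum_singleton]
  simp only [hr]
  have r1 := abs_le.1 (hR (-2) (by norm_num))
  have r2 := abs_le.1 (hR (-1) (by norm_num))
  have r3 := abs_le.1 (hR 0 (by norm_num))
  have r4 := abs_le.1 (hR 1 (by norm_num))
  have r5 := abs_le.1 (hR 2 (by norm_num))
  have p1 := abs_le.1 (hpair (-1) (-2) (by norm_num))
  have p2 := abs_le.1 (hpair 0 (-1) (by norm_num))
  have p3 := abs_le.1 (hpair 1 0 (by norm_num))
  have p4 := abs_le.1 (hpair 2 1 (by norm_num))
  have l1 := abs_le.1 hl1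
  have l2 := abs_le.1 hl2
  have l3 := abs_le.1 hlog'
  rw [show z - (2 : ℤ) - 1 = z - (3 : ℤ) by push_cast; ring] at l3
  norm_num only at *
  rw [abs_le]
  constructor <;> linarith

lemma exists_abs_re_BrjWith_le : ∃ C : ℝ, ∀ z : ℂ, z.im ≠ 0 → |z.re| ≤ 1 / 2 →
    |(BrjWith ((-totalMass : ℝ) : ℂ) z).re| ≤ C := by
  obtain ⟨C, hC⟩ := exists_abs_re_sum_brjTerm_le
  set T := ∑' n : ℤ, 12 * totalMass * (1 / (n : ℝ) ^ 2) with hT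
  have hs : Summable fun n : ℤ => 12 * totalMass * (1 / (n : ℝ) ^ 2) :=
    (Real.summable_one_div_int_pow.2 one_lt_two).mul_left _
  refine ⟨C + T, fun z hz hx => ?_⟩
  have h0 : (-Complex.I * (Real.pi : ℂ) * ((-totalMass : ℝ) : ℂ)).re = 0 := by simp
  have hre : Summable fun n : ℤ => (brjTerm (z - n)).re :=
    Summable.of_norm_bounded (summable_brjTerm z) fun n => Complex.abs_re_le_norm _
  rw [BrjWith_eq, add_re, h0, zero_add, Complex.re_tsum (summable_brjTerm z).of_norm,
    ← hre.sum_add_tsum_compl (s := ({-2, -1, 0, 1, 2} : Finset ℤ))]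
  refine (abs_add_le _ _).trans (add_le_add (hC z hz hx) ?_)
  have hnn : ∀ n : ℤ, 0 ≤ 12 * totalMass * (1 / (n : ℝ) ^ 2) := fun n => by
    have := totalMass_nonneg
    positivity
  set S : Set ℤ := ((({-2, -1, 0, 1, 2} : Finset ℤ) : Set ℤ))ᶜ
  have htail := Summable.tsum_subtype_le _ S hnn hs
  have hsS : Summable fun n : S => 12 * totalMass * (1 / ((n : ℤ) : ℝ) ^ 2) := hs.subtype S
  rw [← Real.norm_eq_abs]
  refine le_trans (tsum_of_norm_bounded hsS.hasSum fun n => ?_) htail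
  obtain ⟨n, hn⟩ := n
  have hn3 : 3 ≤ |n| := by
    have hn' : ¬n ∈ ({-2, -1, 0, 1, 2} : Finset ℤ) := hn
    simp only [Finset.mem_insert, Finset.mem_singleton, not_or] at hn'
    rcases abs_cases n with h | h <;> omega
  have hn3' : (3 : ℝ) ≤ |(n : ℝ)| := by exact_mod_cast hn3
  have hge : |(n : ℝ)| - 1 / 2 ≤ ‖z - n‖ := by
    refine le_trans ?_ (Complex.abs_re_le_norm _)
    rw [sub_re, intCast_re, abs_sub_comm]
    have := abs_sub_abs_le_abs_sub (n : ℝ) z.re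
    linarith
  exact (Complex.abs_re_le_norm _).trans
    (norm_brjTerm_sub_int_le (by linarith) (by linarith) (by rintro rfl; norm_num at hn3))

lemma exists_forall_abs_re_BrjWith_le : ∃ C : ℝ, ∀ z : ℂ, z.im ≠ 0 →
    |(BrjWith ((-totalMass : ℝ) : ℂ) z).re| ≤ C := by
  obtain ⟨C, hC⟩ := exists_abs_re_BrjWith_le
  refine ⟨C, fun z hz => ?_⟩
  rw [← BrjWith_add_int z (-round z.re)]
  refine hC _ (by simpa using hz) ?_
  rw [add_re, intCast_re]
  push_cast
  exact abs_sub_round z.re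

end

/-- construction of the complex Brjuno function `𝓑` and boundedness of
its real part on the upper half-plane (Corollaries 5.8 and 5.9). -/
theorem complex_brjuno_function_re_bounded :
    (∀ K : Set ℂ, IsCompact K → K ⊆ cutPlane 0 1 →
        Summable (fun g : Mmon => ⨆ z ∈ K, ‖Lop g.1 phi0 z‖)) ∧
      sumM phi0 ∈ O1 0 1 ∧
      ∃ a₀ : ℂ,
        Tendsto (fun y : ℝ => Complex.I * (y : ℂ) * sumM phi0 (Complex.I * (y : ℂ)))
            atTop (nhds a₀) ∧
        (∀ z : ℂ, 0 < z.im →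
          Summable (fun n : ℤ => ‖sumM phi0 (z - (n : ℂ)) -
            a₀ * Complex.log ((z - (n : ℂ)) / (z - (n : ℂ) - 1))‖)) ∧
        (∀ K : Set ℂ, IsCompact K → K ⊆ {z : ℂ | 0 < z.im} →
          Summable (fun n : ℤ => ⨆ z ∈ K, ‖sumM phi0 (z - (n : ℂ)) -
            a₀ * Complex.log ((z - (n : ℂ)) / (z - (n : ℂ) - 1))‖)) ∧
        DifferentiableOn ℂ (BrjWith a₀) {z : ℂ | 0 < z.im} ∧
        (∀ z : ℂ, 0 < z.im → BrjWith a₀ (z + 1) = BrjWith a₀ z) ∧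
        ∃ M : ℝ, ∀ z : ℂ, 0 < z.im → |(BrjWith a₀ z).re| ≤ M := by
  refine ⟨fun K hK hK' => summable_iSup_Lop_phi0 hK hK', sumM_phi0_mem_O1,
    ((-totalMass : ℝ) : ℂ), tendsto_mul_sumM_phi0, fun z _ => summable_brjTerm z,
    fun K hK _ => summable_iSup_brjTerm hK, ?_, fun z _ => ?_, ?_⟩
  · exact (differentiableOn_tsum_brjTerm.const_add _).congr fun z _ => BrjWith_eq z
  · exact_mod_cast BrjWith_add_int z 1
  · obtain ⟨M, hM⟩ := exists_forall_abs_re_BrjWith_le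
    exact ⟨M, fun z hz => hM z hz.ne'⟩
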